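/- arXiv:2004.10194 — 11 statements merged into one kernel-verified Lean document; each statement's English description precedes it below -/
import Mathlib

section
/- Let Ω ⊂ ℝ² be a compact convex set with 0 in its interior, and let k be a positive integer, k = ∞, or k = ω (real-analytic). Then the following are equivalent: (i) the boundary of Ω is a regular C^k curve, i.e. there exist L > 0 and an L-periodic C^k map γ : ℝ → ℝ² whose derivative never vanishes, which is injective on [0, L) and whose image equals the frontier of Ω; (ii) the Minkowski gauge functional of Ω is of class C^k on ℝ² ∖ {0}. -/
/-- The planar map `s ↦ (cos s, sin s)`. -/
noncomputable def unitCircleParam (s : ℝ) : ℝ × ℝ := (Real.cos s, Real.sin s)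

theorem unitCircleParam_ne_zero (s : ℝ) : unitCircleParam s ≠ 0 := by
  intro h
  have h1 : Real.cos s = 0 := congrArg Prod.fst h
  have h2 : Real.sin s = 0 := congrArg Prod.snd h
  have := Real.sin_sq_add_cos_sq s
  simp [h1, h2] at this

theorem contDiff_unitCircleParam {n : WithTop ℕ∞} : ContDiff ℝ n unitCircleParam :=
  Real.contDiff_cos.prodMk Real.contDiff_sin

theorem hasDerivAt_unitCircleParam (s : ℝ) :
    HasDerivAt unitCircleParam (-Real.sin s, Real.cos s) s :=
  (Real.hasDerivAt_cos s).prodMk (Real.hasDerivAt_sin s)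

theorem exists_pos_smul_unitCircleParam {x : ℝ × ℝ} (hx : x ≠ 0) :
    ∃ r : ℝ, 0 < r ∧ ∃ s, x = r • unitCircleParam s := by
  let z : ℂ := ⟨x.1, x.2⟩
  have hz0 : z ≠ 0 := by
    intro h
    exact hx (Prod.ext (congrArg Complex.re h) (congrArg Complex.im h))
  exact ⟨‖z‖, norm_pos_iff.2 hz0, z.arg, Prod.ext (Complex.norm_mul_cos_arg z).symm
    (Complex.norm_mul_sin_arg z).symm⟩

theorem eq_of_smul_unitCircleParam_eq {a b s t : ℝ} (ha : 0 < a) (hb : 0 < b)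
    (hs : s ∈ Set.Ico 0 (2 * Real.pi)) (ht : t ∈ Set.Ico 0 (2 * Real.pi))
    (h : a • unitCircleParam s = b • unitCircleParam t) : s = t := by
  have h1 : a * Real.cos s = b * Real.cos t := congrArg Prod.fst h
  have h2 : a * Real.sin s = b * Real.sin t := congrArg Prod.snd h
  have hab : a ^ 2 = b ^ 2 := by
    linear_combination (-a ^ 2) * Real.sin_sq_add_cos_sq s + b ^ 2 * Real.sin_sq_add_cos_sq t +
      (a * Real.cos s + b * Real.cos t) * h1 + (a * Real.sin s + b * Real.sin t) * h2
  obtain rfl : a = b := (sq_eq_sq₀ ha.le hb.le).1 hab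
  have hc : Real.cos s = Real.cos t := mul_left_cancel₀ ha.ne' h1
  have hsn : Real.sin s = Real.sin t := mul_left_cancel₀ ha.ne' h2
  have hcos : Real.cos (s - t) = 1 := by
    rw [Real.cos_sub, hc, hsn]
    linear_combination Real.sin_sq_add_cos_sq t
  have := (Real.cos_eq_one_iff_of_lt_of_lt (by linarith [hs.1, ht.2]) (by linarith [hs.2, ht.1])).1
    hcos
  linarith

/-- At a boundary point of a convex set containing `0` in its interior, the velocity of a regular
curve running in the boundary is transverse to the radial direction. -/
theorem Convex.eq_zero_of_smul_add_smul_eq_zero_of_hasDerivAt {E : Type*} [NormedAddCommGroup E]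
    [NormedSpace ℝ E] {Ω : Set E} (hconv : Convex ℝ Ω) (h0 : (0 : E) ∈ interior Ω)
    {γ : ℝ → E} (hγ : ∀ s, γ s ∈ frontier Ω) {s : ℝ} {v : E} (hv : HasDerivAt γ v s)
    (hv0 : v ≠ 0) {a b : ℝ} (h : a • v + b • γ s = 0) : a = 0 ∧ b = 0 := by
  obtain ⟨f, hf⟩ := geometric_hahn_banach_open_point hconv.interior isOpen_interior (hγ s).2
  have hpos : 0 < f (γ s) := by simpa using hf 0 h0
  have hle : ∀ x ∈ closure Ω, f x ≤ f (γ s) := by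
    rw [← hconv.closure_interior_eq_closure_of_nonempty_interior ⟨0, h0⟩]
    exact fun x hx ↦ closure_minimal (fun y hy ↦ (hf y hy).le)
      (isClosed_le f.continuous continuous_const) hx
  have hfv : f v = 0 := by
    have hmax : IsLocalMax (fun t ↦ f (γ t)) s :=
      Filter.Eventually.of_forall fun t ↦ hle _ (hγ t).1
    exact hmax.hasDerivAt_eq_zero (f.hasFDerivAt.comp_hasDerivAt s hv)
  have hb : b = 0 := by
    have := congrArg f h
    simpa [hfv, hpos.ne'] using this
  refine ⟨?_, hb⟩
  simpa [hb, hv0] using h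

theorem gauge_pos_of_isBounded {E : Type*} [NormedAddCommGroup E] [NormedSpace ℝ E] {Ω : Set E}
    (hb : Bornology.IsBounded Ω) (h0 : (0 : E) ∈ interior Ω) {x : E} (hx : x ≠ 0) :
    0 < gauge Ω x :=
  (gauge_pos (absorbent_nhds_zero (mem_interior_iff_mem_nhds.1 h0))
    (NormedSpace.isVonNBounded_iff ℝ |>.2 hb)).2 hx

theorem contDiffAt_gauge_of_range_eq_frontier {Ω : Set (ℝ × ℝ)} (hb : Bornology.IsBounded Ω)
    (hconv : Convex ℝ Ω) (h0 : (0 : ℝ × ℝ) ∈ interior Ω) {k : WithTop ℕ∞} (hk : 1 ≤ k)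
    {γ : ℝ → ℝ × ℝ} (hγ : ContDiff ℝ k γ) (hγ' : ∀ s, deriv γ s ≠ 0)
    (hrange : Set.range γ = frontier Ω) {x : ℝ × ℝ} (hx : x ≠ 0) :
    ContDiffAt ℝ k (gauge Ω) x := by
  have hk0 : k ≠ 0 := (zero_lt_one.trans_le hk).ne'
  have hnhds := mem_interior_iff_mem_nhds.1 h0
  have hmem : ∀ s, γ s ∈ frontier Ω := fun s ↦ hrange ▸ Set.mem_range_self s
  have hg : 0 < gauge Ω x := gauge_pos_of_isBounded hb h0 hx
  set r := gauge Ω x with hr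
  obtain ⟨s, hs⟩ : r⁻¹ • x ∈ Set.range γ := by
    rw [hrange, ← gauge_eq_one_iff_mem_frontier hconv hnhds,
      gauge_smul_of_nonneg (inv_nonneg.2 hg.le), ← hr, smul_eq_mul, inv_mul_cancel₀ hg.ne']
  let F : ℝ × ℝ → ℝ × ℝ := fun p ↦ p.2 • γ p.1
  have hF : ContDiffAt ℝ k F (s, r) :=
    (contDiff_snd.smul (hγ.comp contDiff_fst)).contDiffAt
  have hFx : F (s, r) = x := by
    change r • γ s = x
    rw [hs, smul_inv_smul₀ hg.ne']
  have hv : HasDerivAt γ (deriv γ s) s := (hγ.differentiable hk0 s).hasDerivAt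
  let A : ℝ × ℝ →L[ℝ] ℝ × ℝ :=
    (ContinuousLinearMap.fst ℝ ℝ ℝ).smulRight (r • deriv γ s) +
      (ContinuousLinearMap.snd ℝ ℝ ℝ).smulRight (γ s)
  have hA : HasFDerivAt F A (s, r) := by
    have h1 : HasFDerivAt (fun p : ℝ × ℝ ↦ γ p.1) _ (s, r) :=
      HasFDerivAt.comp (s, r) hv.hasFDerivAt hasFDerivAt_fst
    refine (hasFDerivAt_snd.smul h1).congr_fderiv ?_
    ext <;> simp [A]
  have hinj : Function.Injective (A : ℝ × ℝ →ₗ[ℝ] ℝ × ℝ) := by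
    refine (injective_iff_map_eq_zero _).2 fun p hp ↦ ?_
    have hp' : (p.1 * r) • deriv γ s + p.2 • γ s = 0 := by
      simpa [A, mul_smul] using hp
    obtain ⟨h1, h2⟩ :=
      hconv.eq_zero_of_smul_add_smul_eq_zero_of_hasDerivAt h0 hmem hv (hγ' s) hp'
    exact Prod.ext ((mul_eq_zero.1 h1).resolve_right hg.ne') h2
  let e : (ℝ × ℝ) ≃L[ℝ] ℝ × ℝ := (LinearEquiv.ofInjectiveEndo _ hinj).toContinuousLinearEquiv
  have he : HasFDerivAt F (e : ℝ × ℝ →L[ℝ] ℝ × ℝ) (s, r) := by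
    refine hA.congr_fderiv ?_
    ext <;> rfl
  have hG := hF.to_localInverse he hk0
  have hGx := hF.localInverse_apply_image he hk0
  have hright : ∀ᶠ y in nhds (F (s, r)), F (hF.localInverse he hk0 y) = y :=
    (hF.hasStrictFDerivAt' he hk0).eventually_right_inverse
  have hpos : ∀ᶠ y in nhds (F (s, r)), 0 < (hF.localInverse he hk0 y).2 :=
    (continuous_snd.continuousAt.comp hG.continuousAt).eventually
      (lt_mem_nhds (by simpa [hGx] using hg))
  rw [← hFx]
  refine (contDiff_snd.contDiffAt.comp _ hG).congr_of_eventuallyEq ?_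
  filter_upwards [hright, hpos] with y hy hy0
  conv_lhs => rw [← hy]
  change gauge Ω ((hF.localInverse he hk0 y).2 • γ _) = _
  rw [gauge_smul_of_nonneg hy0.le, (gauge_eq_one_iff_mem_frontier hconv hnhds).2 (hmem _),
    smul_eq_mul, mul_one, Function.comp_apply]

/-- The radial parametrization of the boundary of a convex set by the polar angle. -/
noncomputable def polarBoundaryParam (Ω : Set (ℝ × ℝ)) (s : ℝ) : ℝ × ℝ :=
  (gauge Ω (unitCircleParam s))⁻¹ • unitCircleParam s

theorem contDiff_gauge_unitCircleParam {Ω : Set (ℝ × ℝ)} {k : WithTop ℕ∞}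
    (h : ContDiffOn ℝ k (gauge Ω) ({0} : Set (ℝ × ℝ))ᶜ) :
    ContDiff ℝ k fun s ↦ gauge Ω (unitCircleParam s) :=
  h.comp_contDiff contDiff_unitCircleParam unitCircleParam_ne_zero

theorem deriv_polarBoundaryParam_ne_zero {Ω : Set (ℝ × ℝ)} {s : ℝ}
    (hpos : 0 < gauge Ω (unitCircleParam s))
    (hd : DifferentiableAt ℝ (fun s ↦ gauge Ω (unitCircleParam s)) s) :
    deriv (polarBoundaryParam Ω) s ≠ 0 := by
  have hder := (hd.hasDerivAt.fun_inv hpos.ne').smul (hasDerivAt_unitCircleParam s)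
  intro h
  have h' := hder.deriv.symm.trans h
  have h1 := congrArg Prod.fst h'
  have h2 := congrArg Prod.snd h'
  simp only [unitCircleParam, Prod.fst_add, Prod.snd_add, Prod.smul_fst, Prod.smul_snd,
    smul_eq_mul, Prod.fst_zero, Prod.snd_zero] at h1 h2
  have : (gauge Ω (unitCircleParam s))⁻¹ = 0 := by
    unfold unitCircleParam
    linear_combination (-Real.sin s) * h1 + Real.cos s * h2 -
      (gauge Ω (Real.cos s, Real.sin s))⁻¹ * Real.sin_sq_add_cos_sq s
  exact (inv_pos.2 hpos).ne' this

theorem range_polarBoundaryParam {Ω : Set (ℝ × ℝ)} (hb : Bornology.IsBounded Ω)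
    (hconv : Convex ℝ Ω) (h0 : (0 : ℝ × ℝ) ∈ interior Ω) :
    Set.range (polarBoundaryParam Ω) = frontier Ω := by
  have hnhds := mem_interior_iff_mem_nhds.1 h0
  have hpos := fun s ↦ gauge_pos_of_isBounded hb h0 (unitCircleParam_ne_zero s)
  ext x
  rw [← gauge_eq_one_iff_mem_frontier hconv hnhds]
  constructor
  · rintro ⟨s, rfl⟩
    rw [polarBoundaryParam, gauge_smul_of_nonneg (inv_pos.2 (hpos s)).le, smul_eq_mul,
      inv_mul_cancel₀ (hpos s).ne']
  · intro hx
    have hx0 : x ≠ 0 := by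
      rintro rfl
      simp at hx
    obtain ⟨r, hr, s, rfl⟩ := exists_pos_smul_unitCircleParam hx0
    rw [gauge_smul_of_nonneg hr.le, smul_eq_mul] at hx
    exact ⟨s, by rw [polarBoundaryParam, ← eq_inv_of_mul_eq_one_left hx]⟩


/-- For a compact convex `Ω ⊆ ℝ²` with `0` in its interior and a smoothness
exponent `k` (a positive integer, `∞`, or `ω`), the boundary of `Ω` is a regular `C^k` curve
iff the Minkowski gauge of `Ω` is `C^k` away from the origin. -/
theorem stmt_0 (Ω : Set (ℝ × ℝ)) (hcomp : IsCompact Ω) (hconv : Convex ℝ Ω)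
    (h0 : (0 : ℝ × ℝ) ∈ interior Ω) (k : WithTop ℕ∞) (hk : 1 ≤ k) :
    (∃ (L : ℝ) (γ : ℝ → ℝ × ℝ), 0 < L ∧ ContDiff ℝ k γ ∧
        (∀ s : ℝ, deriv γ s ≠ 0) ∧ (∀ s : ℝ, γ (s + L) = γ s) ∧
        Set.InjOn γ (Set.Ico 0 L) ∧ Set.range γ = frontier Ω) ↔
      ContDiffOn ℝ k (gauge Ω) ({0} : Set (ℝ × ℝ))ᶜ := by
  have hb := hcomp.isBounded
  constructor
  · rintro ⟨L, γ, -, hγ, hγ', -, -, hrange⟩ x hx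
    exact (contDiffAt_gauge_of_range_eq_frontier hb hconv h0 hk hγ hγ' hrange hx).contDiffWithinAt
  · intro h
    have hpos := fun s ↦ gauge_pos_of_isBounded hb h0 (unitCircleParam_ne_zero s)
    have hg := contDiff_gauge_unitCircleParam h
    refine ⟨2 * Real.pi, polarBoundaryParam Ω, Real.two_pi_pos,
      (hg.inv fun s ↦ (hpos s).ne').smul contDiff_unitCircleParam, fun s ↦ ?_, fun s ↦ ?_,
      fun s hs t ht hst ↦ ?_, range_polarBoundaryParam hb hconv h0⟩
    · exact deriv_polarBoundaryParam_ne_zero (hpos s)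
        (hg.differentiable (zero_lt_one.trans_le hk).ne' s)
    · simp [polarBoundaryParam, unitCircleParam]
    · exact eq_of_smul_unitCircleParam_eq (inv_pos.2 (hpos s)) (inv_pos.2 (hpos t)) hs ht hst
end

section
/- Let Ω ⊂ ℝ² be a compact convex set with 0 in its interior and let k ≥ 1 be an integer. Then the following are equivalent: (i) the boundary of Ω is a regular W^k_∞ curve, i.e. there exist L > 0 and an L-periodic map γ : ℝ → ℝ² of class C^{k−1} whose (k−1)-st derivative is Lipschitz, which is injective on [0, L), whose image equals the frontier of Ω, and such that |γ'(s)| is bounded below by a positive constant for a.e. s; (ii) the 2π-periodic function g(φ) = gauge_Ω(cos φ, sin φ) is of class C^{k−1} on ℝ with Lipschitz (k−1)-st derivative. -/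
open Set Filter Topology MeasureTheory

/-- `IsLocallyLipschitzDeriv n f` says that `f : ℝ → E` is of class `C^n` and that its `n`-th
derivative is locally Lipschitz. -/
def IsLocallyLipschitzDeriv {E : Type*} [NormedAddCommGroup E] [NormedSpace ℝ E] :
    ℕ → (ℝ → E) → Prop
  | 0, f => LocallyLipschitz f
  | n + 1, f => Differentiable ℝ f ∧ IsLocallyLipschitzDeriv n (deriv f)

namespace IsLocallyLipschitzDeriv

variable {E F : Type*} [NormedAddCommGroup E] [NormedSpace ℝ E]
  [NormedAddCommGroup F] [NormedSpace ℝ F]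

theorem iff_contDiff {n : ℕ} {f : ℝ → E} : IsLocallyLipschitzDeriv n f ↔
    ContDiff ℝ n f ∧ LocallyLipschitz (iteratedDeriv n f) := by
  induction n generalizing f with
  | zero =>
    simp only [IsLocallyLipschitzDeriv, iteratedDeriv_zero, Nat.cast_zero, contDiff_zero]
    exact ⟨fun h => ⟨h.continuous, h⟩, fun h => h.2⟩
  | succ n ih =>
    rw [IsLocallyLipschitzDeriv, ih, iteratedDeriv_succ', Nat.cast_add, Nat.cast_one,
      contDiff_succ_iff_deriv]
    simp [and_assoc]

theorem of_contDiff {n : ℕ} {f : ℝ → E} (hf : ContDiff ℝ (n + 1) f) :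
    IsLocallyLipschitzDeriv n f := by
  rw [iff_contDiff]
  refine ⟨hf.of_le (by norm_cast; omega), ContDiff.locallyLipschitz (𝕂 := ℝ) ?_⟩
  rw [iteratedDeriv_eq_iterate]
  exact ContDiff.iterate_deriv' 1 n (by rw [add_comm]; exact_mod_cast hf)

protected theorem contDiff {n : ℕ} {f : ℝ → E} (hf : IsLocallyLipschitzDeriv n f) :
    ContDiff ℝ n f := (iff_contDiff.1 hf).1

protected theorem continuous {n : ℕ} {f : ℝ → E} (hf : IsLocallyLipschitzDeriv n f) :
    Continuous f := hf.contDiff.continuous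

theorem of_succ {n : ℕ} {f : ℝ → E} (hf : IsLocallyLipschitzDeriv (n + 1) f) :
    IsLocallyLipschitzDeriv n f :=
  of_contDiff (by exact_mod_cast hf.contDiff)

theorem mono {m n : ℕ} (hmn : m ≤ n) {f : ℝ → E} (hf : IsLocallyLipschitzDeriv n f) :
    IsLocallyLipschitzDeriv m f := by
  induction hmn with
  | refl => exact hf
  | step _ ih => exact ih hf.of_succ

theorem locallyLipschitz {n : ℕ} {f : ℝ → E} (hf : IsLocallyLipschitzDeriv n f) :
    LocallyLipschitz f := hf.mono (Nat.zero_le n)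

theorem clm_comp {n : ℕ} (L : E →L[ℝ] F) {f : ℝ → E} (hf : IsLocallyLipschitzDeriv n f) :
    IsLocallyLipschitzDeriv n (fun s => L (f s)) := by
  induction n generalizing f with
  | zero => exact L.lipschitz.locallyLipschitz.comp hf
  | succ n ih =>
    have h : ∀ s, HasDerivAt (fun s => L (f s)) (L (deriv f s)) s := fun s =>
      L.hasFDerivAt.comp_hasDerivAt s (hf.1 s).hasDerivAt
    refine ⟨fun s => (h s).differentiableAt, ?_⟩
    rw [show deriv (fun s => L (f s)) = fun s => L (deriv f s) from funext fun s => (h s).deriv]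
    exact ih hf.2

theorem prodMk {n : ℕ} {f : ℝ → E} {g : ℝ → F} (hf : IsLocallyLipschitzDeriv n f)
    (hg : IsLocallyLipschitzDeriv n g) : IsLocallyLipschitzDeriv n (fun s => (f s, g s)) := by
  induction n generalizing f g with
  | zero => exact LocallyLipschitz.prodMk hf hg
  | succ n ih =>
    have h : ∀ s, HasDerivAt (fun s => (f s, g s)) (deriv f s, deriv g s) s := fun s =>
      (hf.1 s).hasDerivAt.prodMk (hg.1 s).hasDerivAt
    refine ⟨fun s => (h s).differentiableAt, ?_⟩
    rw [show deriv (fun s => (f s, g s)) = fun s => (deriv f s, deriv g s) from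
      funext fun s => (h s).deriv]
    exact ih hf.2 hg.2

variable {f g : ℝ → ℝ}

theorem add {n : ℕ} (hf : IsLocallyLipschitzDeriv n f) (hg : IsLocallyLipschitzDeriv n g) :
    IsLocallyLipschitzDeriv n (fun s => f s + g s) :=
  (hf.prodMk hg).clm_comp (ContinuousLinearMap.fst ℝ ℝ ℝ + ContinuousLinearMap.snd ℝ ℝ ℝ)

theorem sub {n : ℕ} (hf : IsLocallyLipschitzDeriv n f) (hg : IsLocallyLipschitzDeriv n g) :
    IsLocallyLipschitzDeriv n (fun s => f s - g s) :=
  (hf.prodMk hg).clm_comp (ContinuousLinearMap.fst ℝ ℝ ℝ - ContinuousLinearMap.snd ℝ ℝ ℝ)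

theorem neg {n : ℕ} (hf : IsLocallyLipschitzDeriv n f) :
    IsLocallyLipschitzDeriv n (fun s => -f s) :=
  hf.clm_comp (-ContinuousLinearMap.id ℝ ℝ)

theorem mul {n : ℕ} (hf : IsLocallyLipschitzDeriv n f) (hg : IsLocallyLipschitzDeriv n g) :
    IsLocallyLipschitzDeriv n (fun s => f s * g s) := by
  induction n generalizing f g with
  | zero =>
    exact (ContDiff.locallyLipschitz (𝕂 := ℝ) (f := fun p : ℝ × ℝ => p.1 * p.2)
      (by fun_prop)).comp (LocallyLipschitz.prodMk hf hg)
  | succ n ih =>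
    refine ⟨hf.1.mul hg.1, ?_⟩
    rw [show deriv (fun s => f s * g s) = fun s => deriv f s * g s + f s * deriv g s from
      funext fun s => ((hf.1 s).hasDerivAt.mul (hg.1 s).hasDerivAt).deriv]
    exact (ih hf.2 hg.of_succ).add (ih hf.of_succ hg.2)

theorem inv {n : ℕ} (hf : IsLocallyLipschitzDeriv n f) (h0 : ∀ s, f s ≠ 0) :
    IsLocallyLipschitzDeriv n (fun s => (f s)⁻¹) := by
  induction n with
  | zero =>
    intro s
    obtain ⟨K, t, ht, hK⟩ := ContDiffAt.exists_lipschitzOnWith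
      (contDiffAt_inv ℝ (n := 1) (h0 s))
    obtain ⟨K', t', ht', hK'⟩ := hf s
    have hc : ContinuousAt f s := (LocallyLipschitz.continuous hf).continuousAt
    exact ⟨K * K', t' ∩ f ⁻¹' t, inter_mem ht' (hc ht),
      hK.comp (hK'.mono inter_subset_left) fun x hx => hx.2⟩
  | succ n ih =>
    refine ⟨fun s => (hf.1 s).inv (h0 s), ?_⟩
    rw [show deriv (fun s => (f s)⁻¹) = fun s => -(deriv f s * ((f s)⁻¹ * (f s)⁻¹)) from
      funext fun s => by
        rw [((hf.1 s).hasDerivAt.fun_inv (h0 s)).deriv]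
        field_simp]
    exact (hf.2.mul ((ih hf.of_succ).mul (ih hf.of_succ))).neg

theorem comp {n : ℕ} (hf : IsLocallyLipschitzDeriv n f) (hg : IsLocallyLipschitzDeriv n g) :
    IsLocallyLipschitzDeriv n (fun s => f (g s)) := by
  induction n generalizing f g with
  | zero => exact LocallyLipschitz.comp hf hg
  | succ n ih =>
    refine ⟨hf.1.comp hg.1, ?_⟩
    rw [show deriv (fun s => f (g s)) = fun s => deriv f (g s) * deriv g s from
      funext fun s => ((hf.1 (g s)).hasDerivAt.comp s (hg.1 s).hasDerivAt).deriv]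
    exact (ih hf.2 hg.of_succ).mul hg.2

theorem cos (n : ℕ) : IsLocallyLipschitzDeriv n Real.cos := of_contDiff Real.contDiff_cos

theorem sin (n : ℕ) : IsLocallyLipschitzDeriv n Real.sin := of_contDiff Real.contDiff_sin

/-- A function whose derivative is bounded below by a positive constant has an inverse of the same
regularity. -/
theorem exists_rightInverse {n : ℕ} {φ w : ℝ → ℝ} (hφ : ∀ s, HasDerivAt φ (w s) s)
    (hw : IsLocallyLipschitzDeriv n w) {c : ℝ} (hc : 0 < c) (hcw : ∀ s, c ≤ w s) :
    ∃ ψ : ℝ → ℝ, IsLocallyLipschitzDeriv (n + 1) ψ ∧ ∀ θ, φ (ψ θ) = θ := by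
  have hd : Differentiable ℝ φ := fun s => (hφ s).differentiableAt
  have hmv : ∀ ⦃a b : ℝ⦄, a ≤ b → c * (b - a) ≤ φ b - φ a :=
    mul_sub_le_image_sub_of_le_deriv hd fun s => (hφ s).deriv.symm ▸ hcw s
  have hsurj : Function.Surjective φ := by
    refine hd.continuous.surjective ?_ ?_
    · refine tendsto_atTop_mono' atTop (f₁ := fun s => φ 0 + c * s) ?_ ?_
      · filter_upwards [eventually_ge_atTop 0] with s hs
        linarith [hmv hs]
      · exact tendsto_atTop_add_const_left _ _ (tendsto_id.const_mul_atTop hc)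
    · refine tendsto_atBot_mono' atBot (?_ : ∀ᶠ s in atBot, φ s ≤ φ 0 + c * s) ?_
      · filter_upwards [eventually_le_atBot 0] with s hs
        linarith [hmv hs]
      · exact tendsto_atBot_add_const_left _ _ (tendsto_id.const_mul_atBot hc)
  obtain ⟨ψ, hψ⟩ := hsurj.hasRightInverse
  have hanti : AntilipschitzWith (Real.toNNReal c⁻¹) φ := by
    refine AntilipschitzWith.of_le_mul_dist fun a b => ?_
    rw [Real.coe_toNNReal _ (inv_nonneg.2 hc.le), Real.dist_eq, Real.dist_eq, inv_mul_eq_div,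
      le_div_iff₀ hc]
    rcases le_total a b with h | h
    · rw [abs_sub_comm, abs_of_nonneg (sub_nonneg.2 h), abs_sub_comm (φ a)]
      linarith [hmv h, le_abs_self (φ b - φ a)]
    · rw [abs_of_nonneg (sub_nonneg.2 h)]
      linarith [hmv h, le_abs_self (φ a - φ b)]
  have hlip := hanti.to_rightInverse hψ
  have hψd : ∀ θ, HasDerivAt ψ (w (ψ θ))⁻¹ θ := fun θ =>
    HasDerivAt.of_local_left_inverse hlip.continuous.continuousAt (hφ _)
      (hc.trans_le (hcw _)).ne' (Eventually.of_forall hψ)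
  refine ⟨ψ, ?_, hψ⟩
  suffices h : ∀ j ≤ n + 1, IsLocallyLipschitzDeriv j ψ from h _ le_rfl
  intro j
  induction j with
  | zero => exact fun _ => hlip.locallyLipschitz
  | succ j ih =>
    intro hj
    refine ⟨fun θ => (hψd θ).differentiableAt, ?_⟩
    rw [show deriv ψ = fun θ => (w (ψ θ))⁻¹ from funext fun θ => (hψd θ).deriv]
    exact ((hw.mono (by omega)).comp (ih (by omega))).inv fun θ => (hc.trans_le (hcw _)).ne'

end IsLocallyLipschitzDeriv

/-- A locally Lipschitz periodic function is globally Lipschitz. -/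
theorem LocallyLipschitz.exists_lipschitzWith_of_periodic {E : Type*} [NormedAddCommGroup E]
    {f : ℝ → E} (hf : LocallyLipschitz f) {T : ℝ} (hT : 0 < T) (hp : Function.Periodic f T) :
    ∃ K, LipschitzWith K f := by
  obtain ⟨K, hK⟩ := (hf.locallyLipschitzOn
    (s := Icc (-1) (T + 1))).exists_lipschitzOnWith_of_compact isCompact_Icc
  obtain ⟨M, hM⟩ := (hp.isBounded_of_continuous hT.ne' hf.continuous).exists_norm_le
  have hM' : ∀ x, ‖f x‖ ≤ M := fun x => hM _ (mem_range_self x)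
  have hM0 : 0 ≤ M := (norm_nonneg _).trans (hM' 0)
  refine ⟨max K (Real.toNNReal (2 * M)), LipschitzWith.of_dist_le_mul fun x y => ?_⟩
  rw [NNReal.coe_max, Real.coe_toNNReal _ (by positivity)]
  by_cases hxy : dist x y ≤ 1
  · obtain ⟨m, hm⟩ : ∃ m : ℤ, x - m • T ∈ Ico 0 T := by
      obtain ⟨m, hm, -⟩ := existsUnique_sub_zsmul_mem_Ico hT x 0
      exact ⟨m, by simpa using hm⟩
    have hd : dist (x - m • T) (y - m • T) = dist x y := by simp
    rw [← hp.sub_zsmul_eq m (x := x), ← hp.sub_zsmul_eq m (x := y), ← hd]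
    have habs := hd.trans_le hxy
    rw [Real.dist_eq, abs_le] at habs
    refine (hK.dist_le_mul _ ⟨by linarith [hm.1], by linarith [hm.2]⟩ _
      ⟨by linarith [hm.1], by linarith [hm.2]⟩).trans ?_
    gcongr
    exact le_max_left _ _
  · push Not at hxy
    calc dist (f x) (f y) ≤ ‖f x‖ + ‖f y‖ := by rw [dist_eq_norm]; exact norm_sub_le _ _
      _ ≤ 2 * M := by linarith [hM' x, hM' y]
      _ ≤ 2 * M * dist x y := le_mul_of_one_le_right (by positivity) hxy.le
      _ ≤ _ := by gcongr; exact le_max_right _ _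

theorem Function.Periodic.deriv {E : Type*} [NormedAddCommGroup E] [NormedSpace ℝ E]
    {f : ℝ → E} {T : ℝ} (hp : Function.Periodic f T) : Function.Periodic (deriv f) T := by
  intro x
  rw [← deriv_comp_add_const, show (fun x => f (x + T)) = f from funext hp]

theorem Function.Periodic.iteratedDeriv {E : Type*} [NormedAddCommGroup E] [NormedSpace ℝ E]
    {f : ℝ → E} {T : ℝ} (hp : Function.Periodic f T) (n : ℕ) :
    Function.Periodic (iteratedDeriv n f) T := by
  induction n with
  | zero => simpa using hp
  | succ n ih => rw [iteratedDeriv_succ]; exact ih.deriv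

theorem IsLocallyLipschitzDeriv.iff_of_periodic {E : Type*} [NormedAddCommGroup E]
    [NormedSpace ℝ E] {n : ℕ} {f : ℝ → E} {T : ℝ} (hT : 0 < T) (hp : Function.Periodic f T) :
    IsLocallyLipschitzDeriv n f ↔
      ContDiff ℝ n f ∧ ∃ K, LipschitzWith K (iteratedDeriv n f) := by
  rw [iff_contDiff]
  refine and_congr_right fun _ => ⟨fun h => ?_, fun ⟨K, hK⟩ => hK.locallyLipschitz⟩
  exact h.exists_lipschitzWith_of_periodic hT (hp.iteratedDeriv n)

/-- A curve on the unit level set of the gauge of a convex neighbourhood of the origin is never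
tangent to its position vector. -/
theorem eq_zero_of_hasDerivAt_smul_of_gauge_eq_one {E : Type*} [NormedAddCommGroup E]
    [NormedSpace ℝ E] {Ω : Set E} (hconv : Convex ℝ Ω) (h0 : Ω ∈ 𝓝 0) {γ : ℝ → E} {s l : ℝ}
    (hγ : ∀ t, gauge Ω (γ t) = 1) (hd : HasDerivAt γ (l • γ s) s) : l = 0 := by
  obtain ⟨K, hK⟩ := hconv.lipschitz_gauge h0
  have hlin : HasDerivAt (fun t => l * (t - s)) l s := by
    simpa using ((hasDerivAt_id s).sub_const s).const_mul l
  have hf : HasDerivAt (fun t => γ t - (1 + l * (t - s)) • γ s) 0 s := by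
    simpa using hd.fun_sub ((hlin.const_add 1).smul_const (γ s))
  rw [hasDerivAt_iff_isLittleO] at hf
  have hzero : HasDerivAt (fun t => l * (t - s)) 0 s := by
    rw [hasDerivAt_iff_isLittleO]
    refine Asymptotics.IsBigO.trans_isLittleO (Asymptotics.IsBigO.of_bound K ?_) hf
    have hpos : ∀ᶠ t in 𝓝 s, 0 < 1 + l * (t - s) :=
      (by fun_prop : Continuous fun t => 1 + l * (t - s)).continuousAt.eventually
        (lt_mem_nhds (by simp))
    filter_upwards [hpos] with t ht
    have h := hK.dist_le_mul (γ t) ((1 + l * (t - s)) • γ s)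
    rw [hγ, gauge_smul_of_nonneg ht.le, hγ, dist_eq_norm, dist_eq_norm, ← norm_neg] at h
    simpa using h
  exact hlin.unique hzero

/-- An angle function obtained by integrating the angular velocity of a planar curve is a polar
angle of the curve. -/
theorem polar_angle_of_hasDerivAt {x y x' y' φ : ℝ → ℝ} (hx : ∀ s, HasDerivAt x (x' s) s)
    (hy : ∀ s, HasDerivAt y (y' s) s) (hne : ∀ s, x s ^ 2 + y s ^ 2 ≠ 0)
    (hφ : ∀ s, HasDerivAt φ ((x s * y' s - y s * x' s) / (x s ^ 2 + y s ^ 2)) s)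
    {r : ℝ} (hr : 0 < r) (hx0 : x 0 = r * Real.cos (φ 0)) (hy0 : y 0 = r * Real.sin (φ 0))
    (s : ℝ) : 0 < x s * Real.cos (φ s) + y s * Real.sin (φ s) ∧
      x s = (x s * Real.cos (φ s) + y s * Real.sin (φ s)) * Real.cos (φ s) ∧
      y s = (x s * Real.cos (φ s) + y s * Real.sin (φ s)) * Real.sin (φ s) := by
  set A : ℝ → ℝ := fun s => x s * Real.cos (φ s) + y s * Real.sin (φ s) with hA
  set B : ℝ → ℝ := fun s => y s * Real.cos (φ s) - x s * Real.sin (φ s) with hB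
  have hAB : ∀ s, A s ^ 2 + B s ^ 2 = x s ^ 2 + y s ^ 2 := fun s => by
    simp only [hA, hB]
    linear_combination (x s ^ 2 + y s ^ 2) * Real.sin_sq_add_cos_sq (φ s)
  have hBd : ∀ s, HasDerivAt B
      (B s * ((x s * x' s + y s * y' s) / (x s ^ 2 + y s ^ 2))) s := fun s => by
    refine (((hy s).mul (hφ s).cos).sub ((hx s).mul (hφ s).sin)).congr_deriv ?_
    simp only [hB]
    field_simp [hne s]
    ring
  have hconst : ∀ s, B s ^ 2 / (x s ^ 2 + y s ^ 2) = B 0 ^ 2 / (x 0 ^ 2 + y 0 ^ 2) := by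
    have hQ : ∀ s, HasDerivAt (fun s => B s ^ 2 / (x s ^ 2 + y s ^ 2)) 0 s := fun s => by
      refine (((hBd s).pow 2).div (((hx s).pow 2).add ((hy s).pow 2)) (hne s)).congr_deriv ?_
      have := hne s
      simp only [Pi.pow_apply, Pi.add_apply]
      field_simp
      ring
    exact fun s => is_const_of_deriv_eq_zero (fun s => (hQ s).differentiableAt)
      (fun s => (hQ s).deriv) s 0
  have hB0 : ∀ s, B s = 0 := fun s => by
    have h := hconst s
    have hB00 : B 0 = 0 := by simp only [hB, hx0, hy0]; ring
    rw [hB00, zero_pow two_ne_zero, zero_div, div_eq_zero_iff] at h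
    exact pow_eq_zero_iff two_ne_zero |>.1 (h.resolve_right (hne s))
  have hA0 : 0 < A 0 := by
    have : A 0 = r := by
      simp only [hA, hx0, hy0]
      linear_combination r * Real.sin_sq_add_cos_sq (φ 0)
    rwa [this]
  have hAc : Continuous A := by
    have h1 : Continuous x := continuous_iff_continuousAt.2 fun s => (hx s).continuousAt
    have h2 : Continuous y := continuous_iff_continuousAt.2 fun s => (hy s).continuousAt
    have h3 : Continuous φ := continuous_iff_continuousAt.2 fun s => (hφ s).continuousAt
    fun_prop
  have hAne : ∀ s, A s ≠ 0 := fun s h => hne s (by rw [← hAB, h, hB0]; ring)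
  refine ⟨?_, ?_, ?_⟩
  · by_contra! hle
    obtain ⟨t, ht⟩ := mem_range_of_exists_le_of_exists_ge hAc ⟨s, hle⟩ ⟨0, hA0.le⟩
    exact hAne t ht
  · have h := hB0 s
    simp only [hB] at h
    linear_combination (-Real.sin (φ s)) * h - x s * Real.sin_sq_add_cos_sq (φ s)
  · have h := hB0 s
    simp only [hB] at h
    linear_combination (Real.cos (φ s)) * h - y s * Real.sin_sq_add_cos_sq (φ s)

section Planar

variable {Ω : Set (ℝ × ℝ)} (hcomp : IsCompact Ω) (hconv : Convex ℝ Ω) (h0 : Ω ∈ 𝓝 0)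

theorem cos_sin_ne_zero (φ : ℝ) : ((Real.cos φ, Real.sin φ) : ℝ × ℝ) ≠ 0 := fun h => by
  have h1 : Real.cos φ = 0 := congrArg Prod.fst h
  have h2 : Real.sin φ = 0 := congrArg Prod.snd h
  simpa [h1, h2] using Real.sin_sq_add_cos_sq φ

theorem exists_polar_coord (x y : ℝ) :
    ∃ r θ, 0 ≤ r ∧ x = r * Real.cos θ ∧ y = r * Real.sin θ :=
  ⟨‖(⟨x, y⟩ : ℂ)‖, (⟨x, y⟩ : ℂ).arg, norm_nonneg _,
    (Complex.norm_mul_cos_arg ⟨x, y⟩).symm, (Complex.norm_mul_sin_arg ⟨x, y⟩).symm⟩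

include hcomp h0 in
theorem gauge_cos_sin_pos (φ : ℝ) : 0 < gauge Ω (Real.cos φ, Real.sin φ) :=
  (gauge_pos (absorbent_nhds_zero h0) (NormedSpace.isVonNBounded_of_isBounded _ hcomp.isBounded)).2
    (cos_sin_ne_zero φ)

include hcomp hconv h0 in
theorem exists_regular_parametrization {n : ℕ}
    (hg : IsLocallyLipschitzDeriv n (fun φ : ℝ => gauge Ω (Real.cos φ, Real.sin φ))) :
    ∃ γ : ℝ → ℝ × ℝ, IsLocallyLipschitzDeriv n γ ∧ Function.Periodic γ (2 * Real.pi) ∧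
      InjOn γ (Ico 0 (2 * Real.pi)) ∧ range γ = frontier Ω ∧
      ∃ c : ℝ, 0 < c ∧ ∀ᵐ s ∂volume, c ≤ ‖deriv γ s‖ := by
  set g : ℝ → ℝ := fun φ => gauge Ω (Real.cos φ, Real.sin φ) with hgdef
  have hpos : ∀ φ, 0 < g φ := gauge_cos_sin_pos hcomp h0
  have hinv := hg.inv fun φ => (hpos φ).ne'
  have hgp : Function.Periodic g (2 * Real.pi) := fun φ => by simp [hgdef]
  set γ : ℝ → ℝ × ℝ := fun φ => ((g φ)⁻¹ * Real.cos φ, (g φ)⁻¹ * Real.sin φ) with hγdef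
  have hγ : IsLocallyLipschitzDeriv n γ :=
    (hinv.mul (.cos n)).prodMk (hinv.mul (.sin n))
  have hγp : Function.Periodic γ (2 * Real.pi) := fun φ => by simp [hγdef, hgp φ]
  have hγs : ∀ φ, γ φ = (g φ)⁻¹ • (Real.cos φ, Real.sin φ) := fun φ => rfl
  refine ⟨γ, hγ, hγp, ?_, ?_, ?_⟩
  · intro a ha b hb hab
    have h1 : (g a)⁻¹ * Real.cos a = (g b)⁻¹ * Real.cos b := congrArg Prod.fst hab
    have h2 : (g a)⁻¹ * Real.sin a = (g b)⁻¹ * Real.sin b := congrArg Prod.snd hab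
    have hA := inv_pos.2 (hpos a)
    have hB := inv_pos.2 (hpos b)
    have h3 : (g a)⁻¹ * Real.cos (a - b) = (g b)⁻¹ := by
      rw [Real.cos_sub]
      linear_combination Real.cos b * h1 + Real.sin b * h2
        + (g b)⁻¹ * Real.sin_sq_add_cos_sq b
    have h4 : (g b)⁻¹ * Real.cos (a - b) = (g a)⁻¹ := by
      rw [Real.cos_sub]
      linear_combination -Real.cos a * h1 - Real.sin a * h2
        + (g a)⁻¹ * Real.sin_sq_add_cos_sq a
    have h5 : (g a)⁻¹ = (g b)⁻¹ := le_antisymm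
      (h4 ▸ mul_le_of_le_one_right hB.le (Real.cos_le_one _))
      (h3 ▸ mul_le_of_le_one_right hA.le (Real.cos_le_one _))
    have h6 : Real.cos (a - b) = 1 := by
      rw [h5] at h3
      exact (mul_eq_left₀ hB.ne').1 h3
    exact sub_eq_zero.1 ((Real.cos_eq_one_iff_of_lt_of_lt (by linarith [ha.1, hb.2])
      (by linarith [ha.2, hb.1])).1 h6)
  · ext p
    rw [← gauge_eq_one_iff_mem_frontier hconv h0]
    constructor
    · rintro ⟨φ, rfl⟩
      rw [hγs, gauge_smul_of_nonneg (inv_nonneg.2 (hpos φ).le)]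
      exact inv_mul_cancel₀ (hpos φ).ne'
    · intro hp
      obtain ⟨r, θ, hr, h1, h2⟩ := exists_polar_coord p.1 p.2
      have hpr : p = r • (Real.cos θ, Real.sin θ) := Prod.ext h1 h2
      rw [hpr, gauge_smul_of_nonneg hr] at hp
      refine ⟨θ, ?_⟩
      rw [hγs, hpr, ← eq_inv_of_mul_eq_one_left hp]
  · obtain ⟨M, hM⟩ := (hgp.isBounded_of_continuous Real.two_pi_pos.ne' hg.continuous).exists_norm_le
    have hgM : ∀ φ, g φ ≤ M := fun φ =>
      (Real.le_norm_self _).trans (hM _ (mem_range_self φ))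
    have hM0 : 0 < M := (hpos 0).trans_le (hgM 0)
    obtain ⟨K, hK⟩ := hγ.locallyLipschitz.exists_lipschitzWith_of_periodic Real.two_pi_pos hγp
    refine ⟨M⁻¹ / 2, by positivity, ?_⟩
    filter_upwards [hK.ae_differentiableAt (μ := volume)] with s hs
    have hd := hs.hasDerivAt
    set v := deriv γ s
    have h1 : HasDerivAt (fun φ => (γ φ).1) v.1 s := hd.fst
    have h2 : HasDerivAt (fun φ => (γ φ).2) v.2 s := hd.snd
    have h3 := (h2.mul (Real.hasDerivAt_cos s)).sub (h1.mul (Real.hasDerivAt_sin s))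
    have h4 : (fun φ => (γ φ).2) * Real.cos - (fun φ => (γ φ).1) * Real.sin = fun _ => 0 := by
      funext φ
      simp only [hγdef, Pi.sub_apply, Pi.mul_apply]
      ring
    rw [h4] at h3
    have h5 := h3.unique (hasDerivAt_const s (0 : ℝ))
    have h6 : v.2 * Real.cos s - v.1 * Real.sin s = (g s)⁻¹ := by
      simp only [hγdef] at h5
      linear_combination h5 + (g s)⁻¹ * Real.sin_sq_add_cos_sq s
    have h7 : |v.2 * Real.cos s| ≤ ‖v‖ := by
      rw [abs_mul]
      exact (mul_le_of_le_one_right (abs_nonneg _) (Real.abs_cos_le_one s)).trans (norm_snd_le v)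
    have h8 : |v.1 * Real.sin s| ≤ ‖v‖ := by
      rw [abs_mul]
      exact (mul_le_of_le_one_right (abs_nonneg _) (Real.abs_sin_le_one s)).trans (norm_fst_le v)
    have h9 : M⁻¹ ≤ (g s)⁻¹ := inv_anti₀ (hpos s) (hgM s)
    linarith [le_abs_self (v.2 * Real.cos s), neg_abs_le (v.1 * Real.sin s)]

include hconv h0 in
theorem isLocallyLipschitzDeriv_gauge {n : ℕ} {γ : ℝ → ℝ × ℝ} {L : ℝ} (hL : 0 < L)
    (hγ : IsLocallyLipschitzDeriv (n + 1) γ) (hp : Function.Periodic γ L)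
    (hfr : ∀ s, γ s ∈ frontier Ω) (hreg : ∀ s, deriv γ s ≠ 0) :
    IsLocallyLipschitzDeriv (n + 1) (fun φ : ℝ => gauge Ω (Real.cos φ, Real.sin φ)) := by
  have hγ1 : ∀ s, gauge Ω (γ s) = 1 := fun s =>
    (gauge_eq_one_iff_mem_frontier hconv h0).2 (hfr s)
  set x : ℝ → ℝ := fun s => (γ s).1 with hxdef
  set y : ℝ → ℝ := fun s => (γ s).2 with hydef
  set x' : ℝ → ℝ := fun s => (deriv γ s).1 with hx'def
  set y' : ℝ → ℝ := fun s => (deriv γ s).2 with hy'def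
  have hγd : ∀ s, HasDerivAt γ (deriv γ s) s := fun s => (hγ.1 s).hasDerivAt
  have hxd : ∀ s, HasDerivAt x (x' s) s := fun s => (hγd s).fst
  have hyd : ∀ s, HasDerivAt y (y' s) s := fun s => (hγd s).snd
  have hx : IsLocallyLipschitzDeriv (n + 1) x := hγ.clm_comp (ContinuousLinearMap.fst ℝ ℝ ℝ)
  have hy : IsLocallyLipschitzDeriv (n + 1) y := hγ.clm_comp (ContinuousLinearMap.snd ℝ ℝ ℝ)
  have hx' : IsLocallyLipschitzDeriv n x' := hγ.2.clm_comp (ContinuousLinearMap.fst ℝ ℝ ℝ)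
  have hy' : IsLocallyLipschitzDeriv n y' := hγ.2.clm_comp (ContinuousLinearMap.snd ℝ ℝ ℝ)
  have hne : ∀ s, x s ^ 2 + y s ^ 2 ≠ 0 := fun s h => by
    have h1 : x s = 0 := by nlinarith [sq_nonneg (x s), sq_nonneg (y s)]
    have h2 : y s = 0 := by nlinarith [sq_nonneg (x s), sq_nonneg (y s)]
    have h3 : γ s = 0 := Prod.ext h1 h2
    simpa [h3] using hγ1 s
  set w : ℝ → ℝ := fun s => (x s * y' s - y s * x' s) / (x s ^ 2 + y s ^ 2) with hwdef
  have hw : IsLocallyLipschitzDeriv n w := by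
    have h1 := (hx.of_succ.mul hy').sub (hy.of_succ.mul hx')
    have h2 := ((hx.of_succ.mul hx.of_succ).add (hy.of_succ.mul hy.of_succ)).inv fun s => by
      simpa only [← sq] using hne s
    simpa only [hwdef, div_eq_mul_inv, sq] using h1.mul h2
  have hwp : Function.Periodic w L := fun s => by
    simp only [hwdef, hxdef, hydef, hx'def, hy'def, hp s, hp.deriv s]
  have hw0 : ∀ s, w s ≠ 0 := fun s h => by
    have h1 : x s * y' s = y s * x' s := by
      simpa [hwdef, hne s, sub_eq_zero] using h
    have hl : deriv γ s = ((x s * x' s + y s * y' s) / (x s ^ 2 + y s ^ 2)) • γ s := by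
      refine Prod.ext ?_ ?_
      · change x' s = (x s * x' s + y s * y' s) / (x s ^ 2 + y s ^ 2) * x s
        field_simp [hne s]
        linear_combination (-y s) * h1
      · change y' s = (x s * x' s + y s * y' s) / (x s ^ 2 + y s ^ 2) * y s
        field_simp [hne s]
        linear_combination (x s) * h1
    refine hreg s ?_
    have hl0 := eq_zero_of_hasDerivAt_smul_of_gauge_eq_one hconv h0 hγ1
      ((hγd s).congr_deriv hl)
    rw [hl, hl0, zero_smul]
  obtain ⟨r, θ₀, hr, hxr, hyr⟩ := exists_polar_coord (x 0) (y 0)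
  have hr0 : 0 < r := hr.lt_of_ne' fun h => hne 0 (by rw [hxr, hyr, h]; ring)
  set φ : ℝ → ℝ := fun s => θ₀ + ∫ t in (0 : ℝ)..s, w t with hφdef
  have hφ0 : φ 0 = θ₀ := by simp [hφdef]
  have hφ : ∀ s, HasDerivAt φ (w s) s := fun s =>
    (hw.continuous.integral_hasStrictDerivAt 0 s).hasDerivAt.const_add θ₀
  have hpol := polar_angle_of_hasDerivAt hxd hyd hne hφ hr0 (hφ0 ▸ hxr) (hφ0 ▸ hyr)
  obtain ⟨ψ, hψ, hφψ⟩ : ∃ ψ : ℝ → ℝ, IsLocallyLipschitzDeriv (n + 1) ψ ∧ ∀ θ, φ (ψ θ) = θ := by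
    obtain ⟨s₀, hs₀⟩ : ∃ s₀, ∀ s, |w s₀| ≤ |w s| := by
      obtain ⟨-, ⟨s₀, rfl⟩, hs₀⟩ := (Function.Periodic.compact_of_continuous
        (f := fun s => |w s|) (fun s => by simp only [hwp s]) hL.ne'
          hw.continuous.abs).exists_isLeast (range_nonempty _)
      exact ⟨s₀, fun s => hs₀ (mem_range_self s)⟩
    have hc : 0 < |w s₀| := abs_pos.2 (hw0 s₀)
    by_cases hsign : ∃ a, 0 < w a
    · have hwpos : ∀ s, 0 < w s := fun s => by
        by_contra! hle
        obtain ⟨a, ha⟩ := hsign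
        obtain ⟨t, ht⟩ := mem_range_of_exists_le_of_exists_ge hw.continuous ⟨s, hle⟩ ⟨a, ha.le⟩
        exact hw0 t ht
      exact IsLocallyLipschitzDeriv.exists_rightInverse hφ hw hc fun s =>
        (hs₀ s).trans_eq (abs_of_pos (hwpos s))
    · push Not at hsign
      obtain ⟨ψ, hψ, h⟩ := IsLocallyLipschitzDeriv.exists_rightInverse
        (φ := fun s => -φ s) (fun s => (hφ s).neg) hw.neg hc fun s =>
        (hs₀ s).trans_eq (abs_of_nonpos (hsign s))
      exact ⟨fun θ => ψ (-θ), hψ.comp (.of_contDiff contDiff_neg),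
        fun θ => neg_injective (h (-θ))⟩
  have hA := ((hx.comp hψ).mul (.cos _)).add ((hy.comp hψ).mul (.sin _))
  have hpolψ := fun θ => hpol (ψ θ)
  simp only [hφψ] at hpolψ
  have hgA := hA.inv fun θ => (hpolψ θ).1.ne'
  convert hgA using 2 with θ
  obtain ⟨h1, h2, h3⟩ := hpolψ θ
  have h4 : γ (ψ θ) = (x (ψ θ) * Real.cos θ + y (ψ θ) * Real.sin θ) •
      (Real.cos θ, Real.sin θ) := Prod.ext h2 h3
  have h5 := hγ1 (ψ θ)
  rw [h4, gauge_smul_of_nonneg h1.le] at h5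
  exact eq_inv_of_mul_eq_one_right h5

end Planar

theorem le_norm_of_ae_le_norm {E : Type*} [NormedAddCommGroup E] {f : ℝ → E} (hf : Continuous f)
    {c : ℝ} (h : ∀ᵐ s ∂volume, c ≤ ‖f s‖) (s : ℝ) : c ≤ ‖f s‖ :=
  (isClosed_le continuous_const hf.norm).closure_subset_iff.2 (fun _ ht => ht)
    (Measure.dense_of_ae h s)

/-- For a compact convex `Ω ⊆ ℝ²` with `0` in its interior and an integer
`k ≥ 1`, the boundary of `Ω` is a regular `W^k_∞` curve iff
`φ ↦ gauge Ω (cos φ, sin φ)` is `C^{k-1}` with Lipschitz `(k-1)`-st derivative. -/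
theorem stmt_1 (Ω : Set (ℝ × ℝ)) (hcomp : IsCompact Ω) (hconv : Convex ℝ Ω)
    (h0 : (0 : ℝ × ℝ) ∈ interior Ω) (k : ℕ) (hk : 1 ≤ k) :
    (∃ (L : ℝ) (γ : ℝ → ℝ × ℝ), 0 < L ∧
        ContDiff ℝ ((k - 1 : ℕ) : WithTop ℕ∞) γ ∧
        (∃ K : NNReal, LipschitzWith K (iteratedDeriv (k - 1) γ)) ∧
        (∀ s : ℝ, γ (s + L) = γ s) ∧
        Set.InjOn γ (Set.Ico 0 L) ∧ Set.range γ = frontier Ω ∧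
        ∃ c : ℝ, 0 < c ∧ ∀ᵐ s ∂MeasureTheory.volume, c ≤ ‖deriv γ s‖) ↔
      (ContDiff ℝ ((k - 1 : ℕ) : WithTop ℕ∞)
          (fun φ : ℝ => gauge Ω (Real.cos φ, Real.sin φ)) ∧
        ∃ K : NNReal,
          LipschitzWith K
            (iteratedDeriv (k - 1) (fun φ : ℝ => gauge Ω (Real.cos φ, Real.sin φ)))) := by
  have hΩ : Ω ∈ 𝓝 0 := mem_interior_iff_mem_nhds.1 h0
  rw [← IsLocallyLipschitzDeriv.iff_of_periodic Real.two_pi_pos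
    (fun φ => by simp only [Real.cos_add_two_pi, Real.sin_add_two_pi])]
  constructor
  · rintro ⟨L, γ, hL, hγ, hγK, hp, -, hr, c, hc, hcγ⟩
    have hγ' := (IsLocallyLipschitzDeriv.iff_of_periodic hL hp).2 ⟨hγ, hγK⟩
    obtain h | ⟨n, hn⟩ : k - 1 = 0 ∨ ∃ n, k - 1 = n + 1 := by
      cases k - 1 <;> simp
    · obtain ⟨K, hK⟩ := hconv.lipschitz_gauge hΩ
      rw [h]
      exact hK.locallyLipschitz.comp
        (((IsLocallyLipschitzDeriv.cos 0).prodMk (.sin 0)).locallyLipschitz)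
    · rw [hn] at hγ' ⊢
      exact isLocallyLipschitzDeriv_gauge hconv hΩ hL hγ' hp (fun s => hr ▸ mem_range_self s)
        fun s => norm_pos_iff.1 (hc.trans_le (le_norm_of_ae_le_norm hγ'.2.continuous hcγ s))
  · intro hg
    obtain ⟨γ, hγ, hp, hinj, hr, hc⟩ := exists_regular_parametrization hcomp hconv hΩ hg
    obtain ⟨h1, h2⟩ := (IsLocallyLipschitzDeriv.iff_of_periodic Real.two_pi_pos hp).1 hγ
    exact ⟨2 * Real.pi, γ, Real.two_pi_pos, h1, h2, hp, hinj, hr, hc⟩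
end

section
/- Let U : ℝ → ℝ be Lipschitz such that at every point x the one-sided derivatives U'₋(x) and U'₊(x) exist and the set {x : U'₋(x) ≠ U'₊(x)} is countable; for x ∈ ℝ let ∂U(x) be the closed segment with endpoints U'₋(x) and U'₊(x). If θ : I → ℝ is C¹ with Lipschitz derivative on an interval I and θ''(t) ∈ −∂U(θ(t)) for a.e. t ∈ I, then the energy E(t) = ½·θ'(t)² + U(θ(t)) is constant on I. -/
open MeasureTheory Set Filter Topology

/-- A level set of a function, restricted to points with nonzero derivative, is countable. -/
lemma countable_setOf_eq_and_deriv_ne_zero {f f' : ℝ → ℝ} {s : Set ℝ}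
    (hf : ∀ x ∈ s, HasDerivWithinAt f (f' x) s x) (c : ℝ) :
    {x | x ∈ s ∧ f x = c ∧ f' x ≠ 0}.Countable := by
  refine (countable_setOfPred_isolated_right_within
    (s := {x | x ∈ s ∧ f x = c ∧ f' x ≠ 0})).mono ?_
  intro x hx
  refine ⟨hx, ?_⟩
  rw [← eventually_false_iff_eq_bot]
  have hne : ∀ᶠ z in 𝓝[s \ {x}] x, f z ≠ c := (hf x hx.1).eventually_ne hx.2.2
  have hsub : {x | x ∈ s ∧ f x = c ∧ f' x ≠ 0} ∩ Ioi x ⊆ s \ {x} :=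
    fun z hz => ⟨hz.1.1, ne_of_gt hz.2⟩
  filter_upwards [hne.filter_mono (nhdsWithin_mono x hsub), self_mem_nhdsWithin] with z hz hzs
  exact hz hzs.1.2.1

/-- A function avoids a given countable set of values at all but countably many of the points where
its derivative does not vanish. -/
lemma countable_setOf_mem_and_deriv_ne_zero {f f' : ℝ → ℝ} {s C : Set ℝ} (hC : C.Countable)
    (hf : ∀ x ∈ s, HasDerivWithinAt f (f' x) s x) :
    {x | x ∈ s ∧ f x ∈ C ∧ f' x ≠ 0}.Countable := by
  refine (hC.biUnion fun c _ => countable_setOf_eq_and_deriv_ne_zero hf c).mono ?_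
  rintro x ⟨hxs, hxC, hx⟩
  exact mem_biUnion hxC ⟨hxs, rfl, hx⟩

/-- Composing a Lipschitz function with a function whose derivative vanishes at a point gives a
function whose derivative vanishes there. -/
lemma LipschitzWith.hasDerivAt_comp_zero {U f : ℝ → ℝ} {K : NNReal} {t : ℝ}
    (hU : LipschitzWith K U) (hf : HasDerivAt f 0 t) : HasDerivAt (fun x => U (f x)) 0 t := by
  rw [hasDerivAt_iff_isLittleO] at hf ⊢
  simp only [smul_zero, sub_zero] at hf ⊢
  refine Asymptotics.IsBigO.trans_isLittleO (Asymptotics.IsBigO.of_bound K ?_) hf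
  exact Eventually.of_forall fun x => by simpa [dist_eq_norm] using hU.dist_le_mul (f x) (f t)


/-- For a Lipschitz `U : ℝ → ℝ` with one-sided derivatives `dm`, `dp`
everywhere, differing only on a countable set, along any `C¹` solution `θ` (with Lipschitz
derivative `θd`) of the differential inclusion `θ'' ∈ -∂U(θ)` on `[a, b]`, the energy
`½ θ'² + U(θ)` is constant. -/
theorem stmt_2 (U dm dp : ℝ → ℝ) (K : NNReal) (hU : LipschitzWith K U)
    (hdm : ∀ x : ℝ, HasDerivWithinAt U (dm x) (Set.Iic x) x)
    (hdp : ∀ x : ℝ, HasDerivWithinAt U (dp x) (Set.Ici x) x)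
    (hcnt : {x : ℝ | dm x ≠ dp x}.Countable)
    (a b : ℝ) (θ θd : ℝ → ℝ) (K' : NNReal)
    (hθ : ∀ t ∈ Set.Icc a b, HasDerivWithinAt θ (θd t) (Set.Icc a b) t)
    (hθd : LipschitzOnWith K' θd (Set.Icc a b))
    (hincl : ∀ᵐ t ∂volume, t ∈ Set.Icc a b →
      ∃ d : ℝ, HasDerivWithinAt θd d (Set.Icc a b) t ∧
        -d ∈ Set.uIcc (dm (θ t)) (dp (θ t))) :
    ∀ s ∈ Set.Icc a b, ∀ t ∈ Set.Icc a b,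
      (1 / 2) * θd s ^ 2 + U (θ s) = (1 / 2) * θd t ^ 2 + U (θ t) := by
  intro s hs t ht
  have hab : a ≤ b := hs.1.trans hs.2
  have hθdc : ContinuousOn θd (Icc a b) := hθd.continuousOn
  have hUθ : AbsolutelyContinuousOnInterval (fun t => U (θ t)) a b := by
    obtain ⟨M, hM⟩ := isCompact_Icc.exists_bound_of_continuousOn hθdc
    have hθL : LipschitzOnWith M.toNNReal θ (Icc a b) :=
      (convex_Icc a b).lipschitzOnWith_of_nnnorm_hasDerivWithin_le hθ fun x hx => by
        rw [← norm_toNNReal]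
        exact Real.toNNReal_le_toNNReal (hM x hx)
    rw [← uIcc_of_le hab] at hθL
    exact (hU.comp_lipschitzOnWith hθL).absolutelyContinuousOnInterval
  have hθdac : AbsolutelyContinuousOnInterval θd a b := by
    rw [← uIcc_of_le hab] at hθd
    exact hθd.absolutelyContinuousOnInterval
  have hE : AbsolutelyContinuousOnInterval (fun t => (1 / 2) * (θd t * θd t) + U (θ t)) a b :=
    ((hθdac.fun_mul hθdac).const_mul (1 / 2)).fun_add hUθ
  have hderiv : ∀ᵐ t, t ∈ uIcc a b →
      HasDerivAt (fun t => (1 / 2) * (θd t * θd t) + U (θ t)) 0 t := by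
    have hends : ({a, b} : Set ℝ).Countable := (countable_singleton b).insert a
    filter_upwards [hincl, (countable_setOf_mem_and_deriv_ne_zero hcnt hθ).ae_notMem volume,
      hends.ae_notMem volume] with t hit hct het ht
    rw [uIcc_of_le hab] at ht
    have hta : t ≠ a := fun h => het (by simp [h])
    have htb : t ≠ b := fun h => het (by simp [h])
    have hnhds : Icc a b ∈ 𝓝 t :=
      Icc_mem_nhds (lt_of_le_of_ne ht.1 hta.symm) (lt_of_le_of_ne ht.2 htb)
    have hθt : HasDerivAt θ (θd t) t := (hθ t ht).hasDerivAt hnhds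
    obtain ⟨d, hd, hdU⟩ := hit ht
    have hdt : HasDerivAt θd d t := hd.hasDerivAt hnhds
    have hkin := (hdt.fun_mul hdt).const_mul (1 / 2 : ℝ)
    by_cases h0 : θd t = 0
    · rw [h0] at hθt
      refine (hkin.fun_add (hU.hasDerivAt_comp_zero hθt)).congr_deriv ?_
      simp [h0]
    · have heq : dm (θ t) = dp (θ t) := by
        by_contra hne
        exact hct ⟨ht, hne, h0⟩
      rw [heq, uIcc_self, mem_singleton_iff] at hdU
      have hUt : HasDerivAt U (dp (θ t)) (θ t) := by
        rw [← hasDerivWithinAt_univ, ← Iic_union_Ici (a := θ t)]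
        exact (heq ▸ hdm (θ t)).union (hdp (θ t))
      refine (hkin.fun_add (hUt.comp t hθt)).congr_deriv ?_
      rw [← hdU]
      ring
  obtain ⟨C, hC⟩ := hE.const_of_ae_hasDerivAt_zero hderiv
  rw [uIcc_of_le hab] at hC
  simp only [pow_two]
  rw [hC s hs, hC t ht]
end

section
/- Let U : ℝ → ℝ be Lipschitz such that at every point x the one-sided derivatives U'₋(x) and U'₊(x) exist and the set {x : U'₋(x) ≠ U'₊(x)} is countable; for x ∈ ℝ let ∂U(x) be the closed segment with endpoints U'₋(x) and U'₊(x). If θ : [a, b] → ℝ is C¹ with θ'(t) ≠ 0 for every t ∈ [a, b] and the energy ½·θ'(t)² + U(θ(t)) is constant on [a, b], then θ' is Lipschitz on [a, b] and θ''(t) ∈ −∂U(θ(t)) for a.e. t ∈ [a, b]. -/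
open MeasureTheory

/-- A continuous nowhere vanishing function on a compact interval has constant sign `σ`, and
`σ * f` is bounded below by a positive constant. -/
theorem ContinuousOn.exists_sign_mul_ge {f : ℝ → ℝ} {a b : ℝ} (hf : ContinuousOn f (Set.Icc a b))
    (hne : ∀ t ∈ Set.Icc a b, f t ≠ 0) :
    ∃ σ m : ℝ, σ ^ 2 = 1 ∧ 0 < m ∧ ∀ t ∈ Set.Icc a b, m ≤ σ * f t := by
  have hsign : ∃ σ : ℝ, σ ^ 2 = 1 ∧ ∀ t ∈ Set.Icc a b, 0 < σ * f t := by
    by_cases hpos : ∀ t ∈ Set.Icc a b, 0 < f t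
    · exact ⟨1, by norm_num, fun t ht => by simpa using hpos t ht⟩
    · push Not at hpos
      obtain ⟨s, hs, hfs⟩ := hpos
      refine ⟨-1, by norm_num, fun t ht => ?_⟩
      by_contra! hft
      obtain ⟨c, hc, hc0⟩ := isPreconnected_Icc.intermediate_value hs ht hf
        (show (0 : ℝ) ∈ Set.Icc (f s) (f t) from ⟨hfs, by linarith⟩)
      exact hne c hc hc0
  obtain ⟨σ, hσ, hpos⟩ := hsign
  rcases (Set.Icc a b).eq_empty_or_nonempty with h | h
  · exact ⟨σ, 1, hσ, one_pos, by simp [h]⟩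
  · obtain ⟨c, hc, hmin⟩ := isCompact_Icc.exists_isMinOn h (hf.const_mul σ)
    exact ⟨σ, σ * f c, hσ, hpos c hc, fun t ht => hmin ht⟩

/-- A function whose derivative vanishes nowhere on a compact interval is injective there. -/
theorem injOn_Icc_of_hasDerivWithinAt_ne_zero {f f' : ℝ → ℝ} {a b : ℝ}
    (hf : ∀ t ∈ Set.Icc a b, HasDerivWithinAt f (f' t) (Set.Icc a b) t)
    (hne : ∀ t ∈ Set.Icc a b, f' t ≠ 0) : Set.InjOn f (Set.Icc a b) := by
  have hlt : ∀ x ∈ Set.Icc a b, ∀ y ∈ Set.Icc a b, x < y → f x ≠ f y := by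
    intro x hx y hy hxy hfxy
    have hsub : Set.Icc x y ⊆ Set.Icc a b := Set.Icc_subset_Icc hx.1 hy.2
    obtain ⟨c, hc, hc0⟩ := exists_hasDerivAt_eq_zero hxy
      (fun t ht => ((hf t (hsub ht)).mono hsub).continuousWithinAt) hfxy
      (fun t ht => (hf t (hsub ⟨ht.1.le, ht.2.le⟩)).hasDerivAt
        (Icc_mem_nhds (hx.1.trans_lt ht.1) (ht.2.trans_le hy.2)))
    exact hne c (hsub ⟨hc.1.le, hc.2.le⟩) hc0
  intro x hx y hy hxy
  by_contra hne'
  rcases lt_or_gt_of_ne hne' with h | h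
  · exact hlt x hx y hy h hxy
  · exact hlt y hy x hx h hxy.symm

/-- Converse of the energy integral: if `θ` is `C¹` on `[a, b]` with nowhere
vanishing derivative `θd` and the energy `½ θ'² + U(θ)` is constant, then `θd` is Lipschitz
on `[a, b]` and `θ` solves the differential inclusion `θ'' ∈ -∂U(θ)` a.e. -/
theorem stmt_3 (U dm dp : ℝ → ℝ) (K : NNReal) (hU : LipschitzWith K U)
    (hdm : ∀ x : ℝ, HasDerivWithinAt U (dm x) (Set.Iic x) x)
    (hdp : ∀ x : ℝ, HasDerivWithinAt U (dp x) (Set.Ici x) x)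
    (hcnt : {x : ℝ | dm x ≠ dp x}.Countable)
    (a b : ℝ) (θ θd : ℝ → ℝ)
    (hθ : ∀ t ∈ Set.Icc a b, HasDerivWithinAt θ (θd t) (Set.Icc a b) t)
    (hθdC : ContinuousOn θd (Set.Icc a b))
    (hne : ∀ t ∈ Set.Icc a b, θd t ≠ 0)
    (hE : ∀ s ∈ Set.Icc a b, ∀ t ∈ Set.Icc a b,
      (1 / 2) * θd s ^ 2 + U (θ s) = (1 / 2) * θd t ^ 2 + U (θ t)) :
    (∃ K' : NNReal, LipschitzOnWith K' θd (Set.Icc a b)) ∧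
      ∀ᵐ t ∂volume, t ∈ Set.Icc a b →
        ∃ d : ℝ, HasDerivWithinAt θd d (Set.Icc a b) t ∧
          -d ∈ Set.uIcc (dm (θ t)) (dp (θ t)) := by
  obtain ⟨σ, m, hσ, hm, hge⟩ := hθdC.exists_sign_mul_ge hne
  constructor
  · obtain ⟨M, hM⟩ := isCompact_Icc.exists_bound_of_continuousOn hθdC
    refine ⟨Real.toNNReal (K * M / m), LipschitzOnWith.of_dist_le_mul fun s hs t ht => ?_⟩
    have hθst : |θ s - θ t| ≤ M * |s - t| := by
      simpa [Real.norm_eq_abs] using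
        (convex_Icc a b).norm_image_sub_le_of_norm_hasDerivWithin_le hθ hM ht hs
    have hUst : |U (θ s) - U (θ t)| ≤ K * |θ s - θ t| := by
      simpa [Real.dist_eq] using hU.dist_le_mul (θ s) (θ t)
    have hsum : 2 * m ≤ |θd s + θd t| := by
      have hσ1 : |σ| = 1 := by
        rcases sq_eq_one_iff.mp hσ with h | h <;> simp [h]
      have h1 : 2 * m ≤ σ * (θd s + θd t) := by linarith [hge s hs, hge t ht]
      have h2 := h1.trans (le_abs_self _)
      rwa [abs_mul, hσ1, one_mul] at h2
    have hprod : |θd s - θd t| * |θd s + θd t| = 2 * |U (θ s) - U (θ t)| := by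
      rw [← abs_mul, show (θd s - θd t) * (θd s + θd t) = -(2 * (U (θ s) - U (θ t))) by
        linarith [hE s hs t ht], abs_neg, abs_mul, abs_two]
    rw [Real.dist_eq, Real.dist_eq]
    refine le_trans ?_ (mul_le_mul_of_nonneg_right (Real.le_coe_toNNReal _) (abs_nonneg _))
    rw [div_mul_eq_mul_div, le_div_iff₀ hm]
    have h1 := mul_le_mul_of_nonneg_left hsum (abs_nonneg (θd s - θd t))
    have h2 := mul_le_mul_of_nonneg_left hθst K.coe_nonneg
    linarith
  · have hbad : (Set.Icc a b ∩ θ ⁻¹' {x | dm x ≠ dp x}).Countable :=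
      Set.MapsTo.countable_of_injOn (f := θ) (fun t ht => ht.2)
        ((injOn_Icc_of_hasDerivWithinAt_ne_zero hθ hne).mono Set.inter_subset_left) hcnt
    filter_upwards [hbad.ae_notMem volume] with t htbad ht
    have heq : dm (θ t) = dp (θ t) := by
      by_contra h
      exact htbad ⟨ht, h⟩
    have hUd : HasDerivAt U (dp (θ t)) (θ t) := by
      have h := (heq ▸ hdm (θ t)).union (hdp (θ t))
      rwa [Set.Iic_union_Ici, hasDerivWithinAt_univ] at h
    refine ⟨-dp (θ t), ?_, by simp⟩
    have hsqrt : ∀ s ∈ Set.Icc a b,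
        θd s = σ * √(θd t ^ 2 + 2 * U (θ t) - 2 * U (θ s)) := by
      intro s hs
      rw [show θd t ^ 2 + 2 * U (θ t) - 2 * U (θ s) = (σ * θd s) ^ 2 by
        rw [mul_pow, hσ]; linarith [hE s hs t ht], Real.sqrt_sq (hm.le.trans (hge s hs)),
        ← mul_assoc, ← sq, hσ, one_mul]
    have hsqrt_t : √(θd t ^ 2 + 2 * U (θ t) - 2 * U (θ t)) = σ * θd t := by
      rw [hsqrt t ht, ← mul_assoc, ← sq, hσ, one_mul, ← hsqrt t ht]
    have hd := (((((hUd.comp_hasDerivWithinAt t (hθ t ht)).const_mul 2).const_sub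
      (θd t ^ 2 + 2 * U (θ t))).sqrt (by simpa using hne t ht)).const_mul σ).congr hsqrt
        (hsqrt t ht)
    have h0 : σ ≠ 0 := by rintro rfl; norm_num at hσ
    have h1 := hne t ht
    have hval : σ * (-(2 * (dp (θ t) * θd t)) / (2 * (σ * θd t))) = -dp (θ t) := by
      field_simp
    rwa [Function.comp_apply, hsqrt_t, hval] at hd
end

section
/- Let U : ℝ → ℝ be Lipschitz such that at every point x the one-sided derivatives U'₋(x) and U'₊(x) exist, with ∂U(x) the closed segment between them, and assume the set-valued map x ↦ ∂U(x) is upper semicontinuous (for every x and ε > 0 there is δ > 0 such that ∂U(x') is contained in the ε-neighbourhood of ∂U(x) whenever |x' − x| < δ). Then for any θ₀, θ₁ ∈ ℝ there exists a C¹ function θ : ℝ → ℝ with Lipschitz derivative such that θ(0) = θ₀, θ'(0) = θ₁, and θ''(t) ∈ −∂U(θ(t)) for a.e. t ∈ ℝ. -/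
open Filter Topology

/-- The symplectic Euler step of size `h` for the acceleration field `-p`; it is a bijection of phase space, so that
it can be iterated in both time directions. -/
noncomputable def symplecticEulerStep (p : ℝ → ℝ) (h : ℝ) : Equiv.Perm (ℝ × ℝ) where
  toFun z := (z.1 + h * z.2, z.2 - h * p (z.1 + h * z.2))
  invFun z := (z.1 - h * (z.2 + h * p z.1), z.2 + h * p z.1)
  left_inv z := by ext <;> simp
  right_inv z := by ext <;> simp

theorem symplecticEulerStep_zpow_add_one (p : ℝ → ℝ) (h : ℝ) (z : ℝ × ℝ) (k : ℤ) :
    (symplecticEulerStep p h ^ (k + 1)) z =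
      symplecticEulerStep p h ((symplecticEulerStep p h ^ k) z) := by
  rw [add_comm, zpow_add, zpow_one, Equiv.Perm.mul_apply]

theorem mul_sub_le_sub_of_forall_le_sub {f : ℤ → ℝ} {A : ℝ} {a b : ℤ} (hab : a ≤ b)
    (hf : ∀ i, a ≤ i → i < b → A ≤ f (i + 1) - f i) : ((b : ℝ) - a) * A ≤ f b - f a := by
  induction b, hab using Int.leInduction with
  | base => simp
  | succ b hab ih =>
    have h₁ := ih fun i hi hib => hf i hi (by lia)
    have h₂ := hf b hab (by lia)
    push_cast
    linarith

theorem sub_le_mul_sub_of_forall_sub_le {f : ℤ → ℝ} {B : ℝ} {a b : ℤ} (hab : a ≤ b)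
    (hf : ∀ i, a ≤ i → i < b → f (i + 1) - f i ≤ B) : f b - f a ≤ ((b : ℝ) - a) * B := by
  have := mul_sub_le_sub_of_forall_le_sub (f := fun i => -f i) (A := -B) hab
    fun i hi hib => by linarith [hf i hi hib]
  linarith

/-- Discrete trajectories for the acceleration field `-p` with time step `h`. -/
structure IsDiscreteTrajectory (p : ℝ → ℝ) (h : ℝ) (x v : ℤ → ℝ) : Prop where
  position : ∀ k, x (k + 1) = x k + h * v k
  velocity : ∀ k, v (k + 1) = v k - h * p (x (k + 1))

theorem exists_isDiscreteTrajectory (p : ℝ → ℝ) (h x₀ v₀ : ℝ) :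
    ∃ x v : ℤ → ℝ, IsDiscreteTrajectory p h x v ∧ x 0 = x₀ ∧ v 0 = v₀ := by
  refine ⟨fun k => ((symplecticEulerStep p h ^ k) (x₀, v₀)).1,
    fun k => ((symplecticEulerStep p h ^ k) (x₀, v₀)).2, ⟨fun k => ?_, fun k => ?_⟩, by simp, by simp⟩
  · simp only [symplecticEulerStep_zpow_add_one]; rfl
  · simp only [symplecticEulerStep_zpow_add_one]; rfl

namespace IsDiscreteTrajectory

variable {p : ℝ → ℝ} {h : ℝ} {x v : ℤ → ℝ} {K : ℝ} {a b : ℤ}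

theorem velocity_sub_mem (H : IsDiscreteTrajectory p h x v) (hh : 0 ≤ h) {m M : ℝ} (hab : a ≤ b)
    (hp : ∀ i, a ≤ i → i ≤ b → p (x i) ∈ Set.Icc m M) :
    v b - v a ∈ Set.Icc (-(h * ((b : ℝ) - a) * M)) (-(h * ((b : ℝ) - a) * m)) := by
  have h₁ := mul_sub_le_sub_of_forall_le_sub (f := v) (A := -(h * M)) hab fun i hi hib => by
    have := mul_le_mul_of_nonneg_left (hp (i + 1) (by lia) (by lia)).2 hh
    linarith [H.velocity i]
  have h₂ := sub_le_mul_sub_of_forall_sub_le (f := v) (B := -(h * m)) hab fun i hi hib => by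
    have := mul_le_mul_of_nonneg_left (hp (i + 1) (by lia) (by lia)).1 hh
    linarith [H.velocity i]
  constructor <;> linarith

theorem abs_velocity_sub_le (H : IsDiscreteTrajectory p h x v) (hh : 0 ≤ h)
    (hp : ∀ y, |p y| ≤ K) (a b : ℤ) : |v b - v a| ≤ K * |h * ((b : ℝ) - a)| := by
  wlog hab : a ≤ b generalizing a b
  · have := this b a (by lia)
    rwa [abs_sub_comm, ← abs_neg (h * _), ← mul_neg, neg_sub] at this
  have := H.velocity_sub_mem hh hab (m := -K) (M := K) fun i _ _ => abs_le.1 (hp _)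
  have hba : (0 : ℝ) ≤ h * ((b : ℝ) - a) := mul_nonneg hh (by simpa using hab)
  rw [abs_of_nonneg hba, abs_le]
  constructor <;> linarith [this.1, this.2]

theorem abs_position_sub_sub_le_of_le (H : IsDiscreteTrajectory p h x v) (hh : 0 ≤ h)
    (hp : ∀ y, |p y| ≤ K) {c : ℤ} (hac : a ≤ c) (hcb : c ≤ b) :
    |x b - x a - h * ((b : ℝ) - a) * v c| ≤ K * (h * ((b : ℝ) - a)) ^ 2 := by
  have hK : 0 ≤ K := (abs_nonneg _).trans (hp 0)
  have key : ∀ i, a ≤ i → i < b → |v i - v c| ≤ K * (h * ((b : ℝ) - a)) := fun i hi hib => by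
    refine (H.abs_velocity_sub_le hh hp c i).trans (mul_le_mul_of_nonneg_left ?_ hK)
    rw [abs_mul, abs_of_nonneg hh]
    refine mul_le_mul_of_nonneg_left ?_ hh
    have h₁ : (a : ℝ) ≤ c := by exact_mod_cast hac
    have h₂ : (c : ℝ) ≤ b := by exact_mod_cast hcb
    have h₃ : (a : ℝ) ≤ i := by exact_mod_cast hi
    have h₄ : (i : ℝ) ≤ b := by exact_mod_cast hib.le
    rw [abs_le]
    constructor <;> linarith
  have h₁ := mul_sub_le_sub_of_forall_le_sub (f := x)
    (A := h * (v c - K * (h * ((b : ℝ) - a)))) (hac.trans hcb) fun i hi hib => by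
      have := mul_le_mul_of_nonneg_left (abs_le.1 (key i hi hib)).1 hh
      linarith [H.position i]
  have h₂ := sub_le_mul_sub_of_forall_sub_le (f := x)
    (B := h * (v c + K * (h * ((b : ℝ) - a)))) (hac.trans hcb) fun i hi hib => by
      have := mul_le_mul_of_nonneg_left (abs_le.1 (key i hi hib)).2 hh
      linarith [H.position i]
  rw [abs_le]
  constructor <;> linarith

theorem abs_position_sub_sub_le (H : IsDiscreteTrajectory p h x v) (hh : 0 ≤ h)
    (hp : ∀ y, |p y| ≤ K) (a b : ℤ) :
    |x b - x a - h * ((b : ℝ) - a) * v a| ≤ K * (h * ((b : ℝ) - a)) ^ 2 := by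
  rcases le_total a b with hab | hba
  · exact H.abs_position_sub_sub_le_of_le hh hp le_rfl hab
  · have := H.abs_position_sub_sub_le_of_le hh hp hba le_rfl
    rw [← abs_neg]
    convert this using 2 <;> ring

end IsDiscreteTrajectory

theorem abs_le_of_lipschitzWith_of_hasDerivWithinAt_Ici {U : ℝ → ℝ} {K : NNReal}
    (hU : LipschitzWith K U) {x d : ℝ} (hd : HasDerivWithinAt U d (Set.Ici x) x) : |d| ≤ K := by
  have ht := (hasDerivWithinAt_iff_tendsto_slope' (by simp)).1 hd.Ioi_of_Ici
  refine le_of_tendsto ht.abs ?_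
  filter_upwards [self_mem_nhdsWithin] with y hy
  have hxy : 0 < y - x := sub_pos.2 hy
  have := hU.dist_le_mul y x
  rw [Real.dist_eq, Real.dist_eq] at this
  rw [slope_def_field, abs_div, div_le_iff₀ (abs_pos.2 hxy.ne')]
  exact this

theorem exists_tendsto_ultrafilter_of_abs_le {ι : Type*} (F : Ultrafilter ι) {f : ι → ℝ} {C : ℝ}
    (hf : ∀ i, |f i| ≤ C) : ∃ y, Tendsto f F (𝓝 y) := by
  obtain ⟨y, -, hy⟩ := (isCompact_Icc (a := -C) (b := C)).ultrafilter_le_nhds' (F.map f)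
    (Ultrafilter.mem_map.2 (Filter.univ_mem' fun i => abs_le.1 (hf i)))
  exact ⟨y, hy⟩

theorem abs_inv_mul_floor_sub_le (n : ℕ) (t : ℝ) :
    |((n : ℝ) + 1)⁻¹ * (⌊((n : ℝ) + 1) * t⌋ : ℝ) - t| ≤ ((n : ℝ) + 1)⁻¹ := by
  have hn : (0 : ℝ) < (n : ℝ) + 1 := by positivity
  have h₁ : ((n : ℝ) + 1)⁻¹ * (⌊((n : ℝ) + 1) * t⌋ : ℝ) - t
      = ((n : ℝ) + 1)⁻¹ * (⌊((n : ℝ) + 1) * t⌋ - ((n : ℝ) + 1) * t) := by field_simp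
  rw [h₁, abs_mul, abs_of_pos (inv_pos.2 hn)]
  refine mul_le_of_le_one_right (inv_pos.2 hn).le ?_
  rw [abs_le]
  constructor <;> linarith [Int.floor_le (((n : ℝ) + 1) * t), Int.lt_floor_add_one (((n : ℝ) + 1) * t)]

theorem tendsto_inv_mul_floor (t : ℝ) :
    Tendsto (fun n : ℕ => ((n : ℝ) + 1)⁻¹ * (⌊((n : ℝ) + 1) * t⌋ : ℝ)) atTop (𝓝 t) := by
  have h0 : Tendsto (fun n : ℕ => ((n : ℝ) + 1)⁻¹) atTop (𝓝 0) := by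
    simpa using tendsto_one_div_add_atTop_nhds_zero_nat (𝕜 := ℝ)
  rw [tendsto_iff_dist_tendsto_zero]
  exact squeeze_zero (fun _ => dist_nonneg) (fun n => abs_inv_mul_floor_sub_le n t) h0

theorem hasDerivAt_of_abs_sub_sub_le_sq {f : ℝ → ℝ} {f' t K : ℝ}
    (hf : ∀ s, |f s - f t - (s - t) * f'| ≤ K * (s - t) ^ 2) : HasDerivAt f f' t := by
  rw [hasDerivAt_iff_isLittleO]
  have hO : (fun s => f s - f t - (s - t) • f') =O[𝓝 t] fun s => (s - t) ^ 2 :=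
    Asymptotics.IsBigO.of_bound K (Eventually.of_forall fun s => by
      simpa [abs_of_nonneg (sq_nonneg (s - t))] using hf s)
  exact hO.trans_isLittleO (by simpa using Asymptotics.isLittleO_pow_sub_sub t one_lt_two)

/-- Limits of discrete trajectories, without any regularity of the force `p`: a `C^{1,1}` trajectory
whose velocity increments over a short time are controlled by the values of `p` nearby. -/
theorem exists_trajectory_of_bounded_force {p : ℝ → ℝ} {K : NNReal} (hp : ∀ y, |p y| ≤ K)
    (θ₀ θ₁ : ℝ) :
    ∃ θ θd : ℝ → ℝ, (∀ t, HasDerivAt θ (θd t) t) ∧ LipschitzWith K θd ∧ θ 0 = θ₀ ∧ θd 0 = θ₁ ∧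
      ∀ (t δ m M : ℝ), 0 < δ → (∀ y, |y - θ t| < δ → p y ∈ Set.Icc m M) →
        ∀ᶠ s in 𝓝[>] t, θd s - θd t ∈ Set.Icc (-((s - t) * M)) (-((s - t) * m)) := by
  choose x v H hx0 hv0 using fun n : ℕ =>
    exists_isDiscreteTrajectory p ((n : ℝ) + 1)⁻¹ θ₀ θ₁
  have hh : ∀ n : ℕ, (0 : ℝ) ≤ ((n : ℝ) + 1)⁻¹ := fun n => by positivity
  have hh1 : ∀ n : ℕ, ((n : ℝ) + 1)⁻¹ ≤ 1 := fun n => inv_le_one_of_one_le₀ (by simp)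
  set k : ℕ → ℝ → ℤ := fun n t => ⌊((n : ℝ) + 1) * t⌋ with hk
  have hk0 : ∀ n, k n 0 = 0 := fun n => by simp [hk]
  have hkmono : ∀ n, Monotone (k n) := fun n s t hst =>
    Int.floor_mono (mul_le_mul_of_nonneg_left hst (by positivity))
  set F : Ultrafilter ℕ := hyperfilter ℕ
  have hF : (F : Filter ℕ) ≤ atTop := Nat.hyperfilter_le_atTop
  have hτ : ∀ s t, Tendsto (fun n : ℕ => ((n : ℝ) + 1)⁻¹ * ((k n s : ℝ) - k n t)) F
      (𝓝 (s - t)) := fun s t => by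
    simpa only [mul_sub] using
      ((tendsto_inv_mul_floor s).sub (tendsto_inv_mul_floor t)).mono_left hF
  have hbd : ∀ (n : ℕ) t, |((n : ℝ) + 1)⁻¹ * (k n t : ℝ)| ≤ |t| + 1 := fun n t => by
    have h₁ := abs_inv_mul_floor_sub_le n t
    have h₂ := abs_add_le (((n : ℝ) + 1)⁻¹ * (k n t : ℝ) - t) t
    rw [sub_add_cancel] at h₂
    linarith [hh1 n]
  have hV : ∀ t, ∃ y, Tendsto (fun n => v n (k n t)) F (𝓝 y) := fun t =>
    exists_tendsto_ultrafilter_of_abs_le F (C := |θ₁| + K * (|t| + 1)) fun n => by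
      have h₁ := (H n).abs_velocity_sub_le (hh n) hp 0 (k n t)
      rw [Int.cast_zero, sub_zero, hv0] at h₁
      have h₂ := abs_add_le (v n (k n t) - θ₁) θ₁
      rw [sub_add_cancel] at h₂
      have h₃ := mul_le_mul_of_nonneg_left (hbd n t) K.coe_nonneg
      linarith
  have hX : ∀ t, ∃ y, Tendsto (fun n => x n (k n t)) F (𝓝 y) := fun t =>
    exists_tendsto_ultrafilter_of_abs_le F
      (C := |θ₀| + (|t| + 1) * |θ₁| + K * (|t| + 1) ^ 2) fun n => by
      have h₁ := (H n).abs_position_sub_sub_le (hh n) hp 0 (k n t)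
      rw [Int.cast_zero, sub_zero, hv0, hx0, ← sq_abs] at h₁
      have h₂ := abs_add_three (x n (k n t) - θ₀ - ((n : ℝ) + 1)⁻¹ * (k n t : ℝ) * θ₁) θ₀
        (((n : ℝ) + 1)⁻¹ * (k n t : ℝ) * θ₁)
      rw [abs_mul _ θ₁] at h₂
      have h₃ := mul_le_mul_of_nonneg_left
        (pow_le_pow_left₀ (abs_nonneg _) (hbd n t) 2) K.coe_nonneg
      have h₄ := mul_le_mul_of_nonneg_right (hbd n t) (abs_nonneg θ₁)
      have h₅ : x n (k n t) - θ₀ - ((n : ℝ) + 1)⁻¹ * (k n t : ℝ) * θ₁ + θ₀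
        + ((n : ℝ) + 1)⁻¹ * (k n t : ℝ) * θ₁ = x n (k n t) := by ring
      rw [h₅] at h₂
      linarith
  choose θ hθ using hX
  choose θd hθd using hV
  refine ⟨θ, θd, fun t => ?_, ?_, ?_, ?_, fun t δ m M hδ hpm => ?_⟩
  · refine hasDerivAt_of_abs_sub_sub_le_sq (K := K) fun s => ?_
    exact le_of_tendsto_of_tendsto' (((hθ s).sub (hθ t)).sub ((hτ s t).mul (hθd t))).abs
      (((hτ s t).pow 2).const_mul (K : ℝ)) fun n => (H n).abs_position_sub_sub_le (hh n) hp _ _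
  · refine LipschitzWith.of_dist_le_mul fun s t => ?_
    rw [Real.dist_eq, Real.dist_eq]
    exact le_of_tendsto_of_tendsto' ((hθd s).sub (hθd t)).abs
      ((hτ s t).abs.const_mul (K : ℝ)) fun n => (H n).abs_velocity_sub_le (hh n) hp _ _
  · refine tendsto_nhds_unique (hθ 0) ?_
    simp only [hk0, hx0, tendsto_const_nhds]
  · refine tendsto_nhds_unique (hθd 0) ?_
    simp only [hk0, hv0, tendsto_const_nhds]
  · have hsmall : ∀ᶠ s in 𝓝[>] t, (s - t) * |θd t| + K * (s - t) ^ 2 < δ := by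
      have hc : Continuous fun s : ℝ => (s - t) * |θd t| + K * (s - t) ^ 2 := by fun_prop
      exact ((hc.tendsto t).mono_left nhdsWithin_le_nhds).eventually_lt_const (by simpa using hδ)
    filter_upwards [hsmall, self_mem_nhdsWithin] with s hs hts
    have hts : t ≤ s := (Set.mem_Ioi.1 hts).le
    have hlim : Tendsto (fun n : ℕ => |x n (k n t) - θ t|
        + (((n : ℝ) + 1)⁻¹ * ((k n s : ℝ) - k n t) * |v n (k n t)|
          + K * (((n : ℝ) + 1)⁻¹ * ((k n s : ℝ) - k n t)) ^ 2)) F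
        (𝓝 (|θ t - θ t| + ((s - t) * |θd t| + K * (s - t) ^ 2))) :=
      ((hθ t).sub_const _).abs.add
        (((hτ s t).mul (hθd t).abs).add (((hτ s t).pow 2).const_mul (K : ℝ)))
    have hmem : ∀ᶠ n : ℕ in F, v n (k n s) - v n (k n t) ∈
        Set.Icc (-(((n : ℝ) + 1)⁻¹ * ((k n s : ℝ) - k n t) * M))
          (-(((n : ℝ) + 1)⁻¹ * ((k n s : ℝ) - k n t) * m)) := by
      filter_upwards [hlim.eventually_lt_const (by simpa using hs)] with n hn
      refine (H n).velocity_sub_mem (hh n) (hkmono n hts) fun i hi his => hpm _ ?_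
      refine lt_of_le_of_lt ?_ hn
      have hi' : (0 : ℝ) ≤ ((n : ℝ) + 1)⁻¹ * ((i : ℝ) - k n t) :=
        mul_nonneg (hh n) (by simpa using hi)
      have hle : ((n : ℝ) + 1)⁻¹ * ((i : ℝ) - k n t)
          ≤ ((n : ℝ) + 1)⁻¹ * ((k n s : ℝ) - k n t) :=
        mul_le_mul_of_nonneg_left (by simpa using his) (hh n)
      have h₁ := (H n).abs_position_sub_sub_le (hh n) hp (k n t) i
      have h₂ := abs_add_three
        (x n i - x n (k n t) - ((n : ℝ) + 1)⁻¹ * ((i : ℝ) - k n t) * v n (k n t))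
        (x n (k n t) - θ t) (((n : ℝ) + 1)⁻¹ * ((i : ℝ) - k n t) * v n (k n t))
      rw [abs_mul _ (v n (k n t)), abs_of_nonneg hi'] at h₂
      have h₃ := mul_le_mul_of_nonneg_left (pow_le_pow_left₀ hi' hle 2) K.coe_nonneg
      have h₄ := mul_le_mul_of_nonneg_right hle (abs_nonneg (v n (k n t)))
      have h₅ : x n i - x n (k n t) - ((n : ℝ) + 1)⁻¹ * ((i : ℝ) - k n t) * v n (k n t)
        + (x n (k n t) - θ t) + ((n : ℝ) + 1)⁻¹ * ((i : ℝ) - k n t) * v n (k n t)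
          = x n i - θ t := by ring
      rw [h₅] at h₂
      linarith
    exact ⟨le_of_tendsto_of_tendsto ((hτ s t).mul_const M).neg ((hθd s).sub (hθd t))
        (hmem.mono fun _ h => h.1),
      le_of_tendsto_of_tendsto ((hθd s).sub (hθd t)) ((hτ s t).mul_const m).neg
        (hmem.mono fun _ h => h.2)⟩

open MeasureTheory

/-- Existence of global solutions of the differential inclusion
`θ'' ∈ -∂U(θ)` for any initial data, for Lipschitz `U` whose subdifferential
`x ↦ [U'₋(x), U'₊(x)]` is upper semicontinuous. -/
theorem stmt_4 (U dm dp : ℝ → ℝ) (K : NNReal) (hU : LipschitzWith K U)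
    (hdm : ∀ x : ℝ, HasDerivWithinAt U (dm x) (Set.Iic x) x)
    (hdp : ∀ x : ℝ, HasDerivWithinAt U (dp x) (Set.Ici x) x)
    (husc : ∀ x : ℝ, ∀ ε > (0 : ℝ), ∃ δ > (0 : ℝ), ∀ x' : ℝ, |x' - x| < δ →
      ∀ y ∈ Set.uIcc (dm x') (dp x'), ∃ y₀ ∈ Set.uIcc (dm x) (dp x), |y - y₀| < ε)
    (θ₀ θ₁ : ℝ) :
    ∃ θ θd : ℝ → ℝ,
      (∀ t : ℝ, HasDerivAt θ (θd t) t) ∧ (∃ K' : NNReal, LipschitzWith K' θd) ∧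
      θ 0 = θ₀ ∧ θd 0 = θ₁ ∧
      ∀ᵐ t ∂volume, ∃ d : ℝ, HasDerivAt θd d t ∧
        -d ∈ Set.uIcc (dm (θ t)) (dp (θ t)) := by
  have hp : ∀ y, |dp y| ≤ K := fun y =>
    abs_le_of_lipschitzWith_of_hasDerivWithinAt_Ici hU (hdp y)
  obtain ⟨θ, θd, hθ, hLip, h0, h0', hinc⟩ := exists_trajectory_of_bounded_force hp θ₀ θ₁
  refine ⟨θ, θd, hθ, ⟨K, hLip⟩, h0, h0', ?_⟩
  filter_upwards [hLip.ae_differentiableAt_real] with t ht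
  refine ⟨deriv θd t, ht.hasDerivAt, ?_⟩
  have hslope := (hasDerivWithinAt_iff_tendsto_slope' (by simp)).1
    (ht.hasDerivAt.hasDerivWithinAt (s := Set.Ioi t))
  have key : ∀ ε > 0, -deriv θd t ∈
      Set.Icc (min (dm (θ t)) (dp (θ t)) - ε) (max (dm (θ t)) (dp (θ t)) + ε) := by
    intro ε hε
    obtain ⟨δ, hδ, hδε⟩ := husc (θ t) ε hε
    have hs := hinc t δ (min (dm (θ t)) (dp (θ t)) - ε) (max (dm (θ t)) (dp (θ t)) + ε) hδ
      fun y hy => by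
        obtain ⟨y₀, hy₀, hlt⟩ := hδε y hy (dp y) Set.right_mem_uIcc
        rw [abs_lt] at hlt
        exact ⟨by linarith [hy₀.1, hlt.1], by linarith [hy₀.2, hlt.2]⟩
    refine isClosed_Icc.mem_of_tendsto hslope.neg ?_
    filter_upwards [hs, self_mem_nhdsWithin] with s hs hts
    have hpos : 0 < s - t := sub_pos.2 hts
    rw [slope_def_field, ← neg_div]
    exact ⟨(le_div_iff₀ hpos).2 (by linarith [hs.2]), (div_le_iff₀ hpos).2 (by linarith [hs.1])⟩
  exact ⟨le_of_forall_pos_le_add fun ε hε => by linarith [(key ε hε).1],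
    le_of_forall_pos_le_add fun ε hε => (key ε hε).2⟩
end

section
/- Let U : ℝ → ℝ be Lipschitz such that at every point x the one-sided derivatives U'₋(x) and U'₊(x) exist and the set {x : U'₋(x) ≠ U'₊(x)} is countable; let ∂U(x) be the closed segment between U'₋(x) and U'₊(x). Suppose U is differentiable with Lipschitz derivative on some open neighbourhood of θ₀ ∈ ℝ. Then for every θ₁ ∈ ℝ, any two solutions of the differential inclusion θ'' ∈ −∂U(θ) with θ(0) = θ₀ and θ'(0) = θ₁ coincide on some neighbourhood of t = 0. -/
open MeasureTheory

/-- `θ` (with derivative `θd`) is a solution on all of `ℝ` of the differential inclusion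
`θ'' ∈ -∂U(θ)`, where `∂U(x)` is the segment between the one-sided derivatives `dm x`, `dp x`:
`θ` is `C¹` with Lipschitz derivative and `θ''(t) ∈ -∂U(θ(t))` for a.e. `t`. -/
def SolInclusion (dm dp θ θd : ℝ → ℝ) : Prop :=
  (∀ t : ℝ, HasDerivAt θ (θd t) t) ∧ (∃ K : NNReal, LipschitzWith K θd) ∧
    ∀ᵐ t ∂MeasureTheory.volume, ∃ d : ℝ, HasDerivAt θd d t ∧
      -d ∈ Set.uIcc (dm (θ t)) (dp (θ t))

section

open Set Filter Topology

/-- A Lipschitz function whose derivative agrees almost everywhere on an open interval with a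
continuous function is differentiable there, with that derivative. -/
theorem LipschitzWith.hasDerivAt_of_ae_eq_continuous {f g : ℝ → ℝ} {K : NNReal} {a b : ℝ}
    (hf : LipschitzWith K f) (hg : Continuous g)
    (h : ∀ᵐ t, t ∈ Ioo a b → HasDerivAt f (g t) t) {t : ℝ} (ht : t ∈ Ioo a b) :
    HasDerivAt f (g t) t := by
  have key : ∀ s ∈ Ioo a b, f s = f t + ∫ u in t..s, g u := by
    intro s hs
    have hac : AbsolutelyContinuousOnInterval f t s :=
      (hf.lipschitzOnWith (s := uIcc t s)).absolutelyContinuousOnInterval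
    have hcongr : ∫ u in t..s, deriv f u = ∫ u in t..s, g u := by
      refine intervalIntegral.integral_congr_ae ?_
      filter_upwards [h] with u hu hmem
      exact (hu (ordConnected_Ioo.uIcc_subset ht hs (uIoc_subset_uIcc hmem))).deriv
    rw [← hcongr, hac.integral_deriv_eq_sub]
    ring
  have hderiv : HasDerivAt (fun s => f t + ∫ u in t..s, g u) (g t) t :=
    (hg.integral_hasStrictDerivAt t t).hasDerivAt.const_add (f t)
  refine hderiv.congr_of_eventuallyEq ?_
  filter_upwards [Ioo_mem_nhds ht.1 ht.2] with s hs using key s hs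

/-- If the one-sided derivatives equal a continuous `g` near `θ t₀`, a solution of the
differential inclusion solves the equation `θ'' = -g(θ)` near `t₀`. -/
theorem SolInclusion.eventually_hasDerivAt {dm dp θ θd g : ℝ → ℝ} {V : Set ℝ} {t₀ : ℝ}
    (hθ : SolInclusion dm dp θ θd) (hV : V ∈ 𝓝 (θ t₀)) (hg : Continuous g)
    (hm : EqOn dm g V) (hp : EqOn dp g V) :
    ∀ᶠ t in 𝓝 t₀, HasDerivAt θd (-g (θ t)) t := by
  obtain ⟨hd, ⟨L, hL⟩, hae⟩ := hθ
  have hcont : Continuous θ := continuous_iff_continuousAt.2 fun t => (hd t).continuousAt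
  obtain ⟨a, b, hab, hsub⟩ := mem_nhds_iff_exists_Ioo_subset.1 (hcont.continuousAt hV)
  filter_upwards [Ioo_mem_nhds hab.1 hab.2] with t ht
  refine hL.hasDerivAt_of_ae_eq_continuous (g := fun s => -g (θ s)) (by fun_prop) ?_ ht
  filter_upwards [hae] with s hs hmem
  obtain ⟨d, hd, hin⟩ := hs
  rw [hm (hsub hmem), hp (hsub hmem), uIcc_self, mem_singleton_iff] at hin
  rwa [← hin, neg_neg]

/-- Local uniqueness for the second-order equation `θ'' = -g(θ)` with Lipschitz `g`. -/
theorem eventuallyEq_of_second_order_ode {g θ θd η ηd : ℝ → ℝ} {K : NNReal} {t₀ : ℝ}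
    (hg : LipschitzWith K g)
    (hθ : ∀ t, HasDerivAt θ (θd t) t) (hθd : ∀ᶠ t in 𝓝 t₀, HasDerivAt θd (-g (θ t)) t)
    (hη : ∀ t, HasDerivAt η (ηd t) t) (hηd : ∀ᶠ t in 𝓝 t₀, HasDerivAt ηd (-g (η t)) t)
    (h : θ t₀ = η t₀) (hd : θd t₀ = ηd t₀) : θ =ᶠ[𝓝 t₀] η := by
  have hv : LipschitzWith _ fun p : ℝ × ℝ => (p.2, -g p.1) :=
    LipschitzWith.prod_snd.prodMk (hg.comp LipschitzWith.prod_fst).neg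
  have heq : (fun t => (θ t, θd t)) =ᶠ[𝓝 t₀] fun t => (η t, ηd t) := by
    refine ODE_solution_unique_of_eventually (s := fun _ => univ)
      (v := fun _ p => (p.2, -g p.1))
      (.of_forall fun _ => hv.lipschitzOnWith) ?_ ?_ (Prod.ext h hd)
    · filter_upwards [hθd] with t ht using ⟨(hθ t).prodMk ht, mem_univ _⟩
    · filter_upwards [hηd] with t ht using ⟨(hη t).prodMk ht, mem_univ _⟩
  filter_upwards [heq] with t ht using congrArg Prod.fst ht

end

/-- If `U` is differentiable with Lipschitz derivative on an open
neighbourhood of `θ₀`, then any two solutions of `θ'' ∈ -∂U(θ)` with `θ(0) = θ₀`,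
`θ'(0) = θ₁` coincide near `t = 0`. -/
theorem stmt_5 (U dm dp : ℝ → ℝ) (K : NNReal) (hU : LipschitzWith K U)
    (hdm : ∀ x : ℝ, HasDerivWithinAt U (dm x) (Set.Iic x) x)
    (hdp : ∀ x : ℝ, HasDerivWithinAt U (dp x) (Set.Ici x) x)
    (hcnt : {x : ℝ | dm x ≠ dp x}.Countable)
    (θ₀ θ₁ : ℝ)
    (hsmooth : ∃ V : Set ℝ, IsOpen V ∧ θ₀ ∈ V ∧
      ∃ (U' : ℝ → ℝ) (K₁ : NNReal),
        (∀ x ∈ V, HasDerivAt U (U' x) x) ∧ LipschitzOnWith K₁ U' V)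
    (θ θd η ηd : ℝ → ℝ)
    (hθ : SolInclusion dm dp θ θd) (hθ0 : θ 0 = θ₀) (hθd0 : θd 0 = θ₁)
    (hη : SolInclusion dm dp η ηd) (hη0 : η 0 = θ₀) (hηd0 : ηd 0 = θ₁) :
    ∃ ε > (0 : ℝ), ∀ t : ℝ, |t| < ε → θ t = η t := by
  obtain ⟨V, hVo, hmem, U', K₁, hU', hLip⟩ := hsmooth
  obtain ⟨g, hg, hgV⟩ := hLip.extend_real
  have hm : Set.EqOn dm g V := fun x hx =>
    ((uniqueDiffWithinAt_Iic x).eq_deriv _ (hdm x) (hU' x hx).hasDerivWithinAt).trans (hgV hx)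
  have hp : Set.EqOn dp g V := fun x hx =>
    ((uniqueDiffWithinAt_Ici x).eq_deriv _ (hdp x) (hU' x hx).hasDerivWithinAt).trans (hgV hx)
  have hV := hVo.mem_nhds hmem
  have heq := eventuallyEq_of_second_order_ode hg
    hθ.1 (hθ.eventually_hasDerivAt (hθ0 ▸ hV) hg.continuous hm hp)
    hη.1 (hη.eventually_hasDerivAt (hη0 ▸ hV) hg.continuous hm hp)
    (hθ0.trans hη0.symm) (hθd0.trans hηd0.symm)
  obtain ⟨ε, hε, hball⟩ := Metric.eventually_nhds_iff.1 heq
  exact ⟨ε, hε, fun t ht => hball (by simpa [Real.dist_eq] using ht)⟩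
end

section
/- Let U : ℝ → ℝ be Lipschitz such that at every point x the one-sided derivatives U'₋(x) and U'₊(x) exist and the set {x : U'₋(x) ≠ U'₊(x)} is countable; let ∂U(x) be the closed segment between U'₋(x) and U'₊(x). Fix θ₀ ∈ ℝ and θ₁ ≠ 0, and set E = ½·θ₁² + U(θ₀). Then there exists a solution of the differential inclusion θ'' ∈ −∂U(θ) with θ(0) = θ₀, θ'(0) = θ₁, any two such solutions coincide on a neighbourhood of t = 0, and every such solution satisfies √2·t = sgn(θ₁)·∫_{θ₀}^{θ(t)} (E − U(ψ))^{−1/2} dψ for all t in some neighbourhood of 0. -/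
open MeasureTheory

section

open Set Filter Topology
open scoped NNReal

/-- Mean value inequalities for a function with a right derivative in `[m, M]`. -/
theorem mul_sub_le_sub_le_of_right_deriv_mem {f f' : ℝ → ℝ} {a b m M : ℝ} (hab : a ≤ b)
    (hf : ContinuousOn f (Icc a b))
    (hf' : ∀ x ∈ Ico a b, HasDerivWithinAt f (f' x) (Ici x) x)
    (hm : ∀ x ∈ Ico a b, f' x ∈ Icc m M) :
    m * (b - a) ≤ f b - f a ∧ f b - f a ≤ M * (b - a) := by
  have hlin (C A : ℝ) (x : ℝ) : HasDerivAt (fun y => A + C * (y - a)) C x := by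
    simpa using (((hasDerivAt_id x).sub_const a).const_mul C).const_add A
  constructor
  · have := image_le_of_deriv_right_le_deriv_boundary (B := f) (B' := f')
      (fun x _ => (hlin m (f a) x).continuousAt.continuousWithinAt)
      (fun x _ => (hlin m (f a) x).hasDerivWithinAt) (by simp) hf hf'
      (fun x hx => (hm x hx).1) (right_mem_Icc.2 hab)
    linarith
  · have := image_le_of_deriv_right_le_deriv_boundary hf hf' (B' := fun _ => M) (by simp)
      (fun x _ => (hlin M (f a) x).continuousAt.continuousWithinAt)
      (fun x _ => (hlin M (f a) x).hasDerivWithinAt)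
      (fun x hx => (hm x hx).2) (right_mem_Icc.2 hab)
    linarith

/-- A Newton equation with a bounded Lipschitz force has a solution on any interval `(-T, T)`. -/
theorem exists_newton_solution_Ioo {g : ℝ → ℝ} {L K : ℝ≥0} (hg : LipschitzWith L g)
    (hK : ∀ x, |g x| ≤ K) (x₀ v₀ : ℝ) {T : ℝ} (hT : 0 < T) :
    ∃ x v : ℝ → ℝ, x 0 = x₀ ∧ v 0 = v₀ ∧
      ∀ t ∈ Ioo (-T) T, HasDerivAt x (v t) t ∧ HasDerivAt v (-g (x t)) t := by
  set M : ℝ := |v₀| + K * T with hM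
  have hM0 : 0 ≤ M := by positivity
  -- truncating the velocity makes the vector field bounded
  let c : ℝ → ℝ := fun y => max (-M) (min M y)
  have hc : LipschitzWith 1 c := (LipschitzWith.id.const_min M).const_max (-M)
  have hcM (y : ℝ) : |c y| ≤ M := by
    rw [abs_le]; exact ⟨le_max_left _ _, max_le (by linarith) (min_le_left _ _)⟩
  let f : ℝ → ℝ × ℝ → ℝ × ℝ := fun _ p => (c p.2, -g p.1)
  have hf (t : ℝ) : LipschitzWith (max (1 * 1) (L * 1)) (f t) :=
    (hc.comp LipschitzWith.prod_snd).prodMk (hg.neg.comp LipschitzWith.prod_fst)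
  let R : ℝ≥0 := ⟨max M K, le_max_of_le_left hM0⟩
  let t₀ : Icc (-T) T := ⟨0, by constructor <;> linarith⟩
  have hpl : IsPicardLindelof f t₀ (x₀, v₀) (R * ⟨T, hT.le⟩) 0 R (max (1 * 1) (L * 1)) :=
    { lipschitzOnWith := fun t _ => (hf t).lipschitzOnWith
      continuousOn := fun x _ => continuousOn_const
      norm_le := fun t _ p _ => by
        rw [Prod.norm_def]
        refine max_le ?_ ?_
        · exact (hcM p.2).trans (le_max_left _ _)
        · exact (norm_neg (g p.1)).le.trans ((hK p.1).trans (le_max_right _ _))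
      mul_max_le := by
        simp only [t₀, sub_zero, zero_sub, neg_neg, max_self, NNReal.coe_zero]
        exact le_rfl }
  obtain ⟨α, hα0, hα⟩ := hpl.exists_eq_forall_mem_Icc_hasDerivWithinAt₀
  replace hα0 : α 0 = (x₀, v₀) := hα0
  have hα' : ∀ t ∈ Ioo (-T) T, HasDerivAt α (f t (α t)) t := fun t ht =>
    (hα t (Ioo_subset_Icc_self ht)).hasDerivAt (Icc_mem_nhds ht.1 ht.2)
  have h1 : ∀ t ∈ Ioo (-T) T, HasDerivAt (fun s => (α s).1) (c (α t).2) t := fun t ht =>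
    (hα' t ht).fst
  have h2 : ∀ t ∈ Ioo (-T) T, HasDerivAt (fun s => (α s).2) (-g (α t).1) t := fun t ht =>
    (hα' t ht).snd
  refine ⟨fun s => (α s).1, fun s => (α s).2, by simp [hα0], by simp [hα0],
    fun t ht => ⟨?_, h2 t ht⟩⟩
  have hbd : |(α t).2 - v₀| ≤ K * |t| := by
    have := (convex_Ioo (-T) T).norm_image_sub_le_of_norm_hasDerivWithin_le (C := K) (x := 0) (y := t)
      (fun s hs => (h2 s hs).hasDerivWithinAt)
      (fun s _ => by simpa using hK _) ⟨by linarith, hT⟩ ht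
    simpa [hα0] using this
  have hle : |(α t).2| ≤ M := by
    have h3 : |t| ≤ T := abs_le.2 ⟨ht.1.le, ht.2.le⟩
    have h4 : (K : ℝ) * |t| ≤ K * T := by gcongr
    have h5 := abs_sub_abs_le_abs_sub (α t).2 v₀
    linarith
  have hceq : c (α t).2 = (α t).2 := by
    rw [abs_le] at hle
    simp only [c, min_eq_right hle.2, max_eq_right hle.1]
  simpa only [hceq] using h1 t ht

/-- An eventually bounded real sequence converges along an ultrafilter. -/
theorem Ultrafilter.exists_tendsto_of_abs_le {ι : Type*} (F : Ultrafilter ι) {u : ι → ℝ} {C : ℝ}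
    (hu : ∀ᶠ n in (F : Filter ι), |u n| ≤ C) : ∃ x, Tendsto u F (𝓝 x) := by
  have hc : IsCompact (Icc (-C) C) := isCompact_Icc
  obtain ⟨x, -, hx⟩ := isCompact_iff_ultrafilter_le_nhds'.1 hc (F.map u)
    (mem_map.2 (by filter_upwards [hu] with n hn using abs_le.1 hn))
  exact ⟨x, hx⟩

theorem hasDerivAt_of_abs_sub_le_sq {f : ℝ → ℝ} {d C t : ℝ}
    (h : ∀ s, |f s - f t - (s - t) * d| ≤ C * (s - t) ^ 2) : HasDerivAt f d t := by
  rw [hasDerivAt_iff_isLittleO]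
  have h1 : (fun s => f s - f t - (s - t) • d) =O[𝓝 t] fun s => (s - t) ^ 2 :=
    Asymptotics.IsBigO.of_bound C (Eventually.of_forall fun s => by
      simpa [abs_of_nonneg (sq_nonneg (s - t))] using h s)
  refine h1.trans_isLittleO ?_
  have h2 : (fun s : ℝ => (s - t) ^ 2) =o[𝓝 t] fun s => (s - t) ^ 1 :=
    (Asymptotics.isLittleO_pow_pow (one_lt_two)).comp_tendsto
      (tendsto_sub_nhds_zero_iff.2 tendsto_id)
  simpa using h2

/-- Bounds on the one-sided derivative near `x₀` pass to forward difference quotients. -/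
theorem LipschitzWith.slope_mem_Icc_of_right_deriv_mem {U dp : ℝ → ℝ} {K : ℝ≥0}
    (hU : LipschitzWith K U) (hdp : ∀ x, HasDerivWithinAt U (dp x) (Ici x) x) {x h m M : ℝ}
    (hh : 0 < h) (hm : ∀ y ∈ Ico x (x + h), dp y ∈ Icc m M) :
    h⁻¹ * (U (x + h) - U x) ∈ Icc m M := by
  have := mul_sub_le_sub_le_of_right_deriv_mem (by linarith) hU.continuous.continuousOn
    (fun y _ => hdp y) hm
  rw [add_sub_cancel_left] at this
  rw [inv_mul_eq_div]
  exact ⟨(le_div_iff₀ hh).2 this.1, (div_le_iff₀ hh).2 this.2⟩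

theorem LipschitzWith.exists_newton_solution_slope {U : ℝ → ℝ} {K : ℝ≥0}
    (hU : LipschitzWith K U) (x₀ v₀ : ℝ) {h T : ℝ} (hh : 0 < h) (hT : 0 < T) :
    ∃ x v : ℝ → ℝ, x 0 = x₀ ∧ v 0 = v₀ ∧ ∀ t ∈ Ioo (-T) T, HasDerivAt x (v t) t ∧
      HasDerivAt v (-(h⁻¹ * (U (x t + h) - U (x t)))) t ∧
      |h⁻¹ * (U (x t + h) - U (x t))| ≤ K := by
  have hb (y : ℝ) : |h⁻¹ * (U (y + h) - U y)| ≤ K := by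
    have := hU.dist_le_mul (y + h) y
    simp only [Real.dist_eq, add_sub_cancel_left, abs_of_pos hh] at this
    rw [abs_mul, abs_of_pos (inv_pos.2 hh), inv_mul_eq_div]
    exact (div_le_iff₀ hh).2 this
  have hL : LipschitzWith (‖h⁻¹‖₊ * (K * (1 + 0) + K)) fun y => h⁻¹ * (U (y + h) - U y) :=
    (lipschitzWith_smul h⁻¹).comp
      ((hU.comp (LipschitzWith.id.add (LipschitzWith.const h))).sub hU)
  obtain ⟨x, v, h0, h1, h2⟩ := exists_newton_solution_Ioo hL hb x₀ v₀ hT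
  exact ⟨x, v, h0, h1, fun t ht => ⟨(h2 t ht).1, (h2 t ht).2, hb _⟩⟩

/-- Global existence for `θ'' ∈ -∂U(θ)`: replace the derivative of `U` by forward difference quotients with
step `1 / (n + 1)` and pass to the pointwise limit along an ultrafilter. -/
theorem exists_solInclusion {U dm dp : ℝ → ℝ} {K : ℝ≥0} (hU : LipschitzWith K U)
    (hdp : ∀ x : ℝ, HasDerivWithinAt U (dp x) (Set.Ici x) x)
    (husc : ∀ x : ℝ, ∀ ε > (0 : ℝ), ∃ δ > (0 : ℝ), ∀ x' : ℝ, |x' - x| < δ →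
      ∀ y ∈ Set.uIcc (dm x') (dp x'), ∃ y₀ ∈ Set.uIcc (dm x) (dp x), |y - y₀| < ε)
    (θ₀ θ₁ : ℝ) : ∃ θ θd : ℝ → ℝ, SolInclusion dm dp θ θd ∧ θ 0 = θ₀ ∧ θd 0 = θ₁ := by
  have hpos (n : ℕ) : (0 : ℝ) < n + 1 := by positivity
  choose x v hx0 hv0 hxv using fun n : ℕ =>
    hU.exists_newton_solution_slope θ₀ θ₁ (inv_pos.2 (hpos n)) (hpos n)
  have hlip (n : ℕ) {s t : ℝ} (hs : s ∈ Ioo (-(n + 1 : ℝ)) (n + 1))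
      (ht : t ∈ Ioo (-(n + 1 : ℝ)) (n + 1)) : |v n s - v n t| ≤ K * |s - t| :=
    (convex_Ioo _ _).norm_image_sub_le_of_norm_hasDerivWithin_le
      (fun r hr => (hxv n r hr).2.1.hasDerivWithinAt)
      (fun r hr => by simpa only [norm_neg, Real.norm_eq_abs] using (hxv n r hr).2.2) ht hs
  have hquad (n : ℕ) {s t : ℝ} (hs : s ∈ Ioo (-(n + 1 : ℝ)) (n + 1))
      (ht : t ∈ Ioo (-(n + 1 : ℝ)) (n + 1)) :
      |x n s - x n t - (s - t) * v n t| ≤ K * (s - t) ^ 2 := by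
    have hsub : uIcc t s ⊆ Ioo (-(n + 1 : ℝ)) (n + 1) := ordConnected_Ioo.uIcc_subset ht hs
    have h := (convex_uIcc t s).norm_image_sub_le_of_norm_hasDerivWithin_le
      (f := fun r => x n r - r * v n t) (f' := fun r => v n r - 1 * v n t) (C := K * |s - t|)
      (fun r hr => ((hxv n r (hsub hr)).1.sub
        ((hasDerivAt_id r).mul_const (v n t))).hasDerivWithinAt)
      (fun r hr => by
        rw [one_mul]
        refine (hlip n (hsub hr) ht).trans ?_
        exact mul_le_mul_of_nonneg_left (abs_sub_left_of_mem_uIcc hr) K.coe_nonneg)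
      left_mem_uIcc right_mem_uIcc
    rw [Real.norm_eq_abs, Real.norm_eq_abs, mul_assoc, ← sq, sq_abs] at h
    convert h using 2
    ring
  let F : Ultrafilter ℕ := hyperfilter ℕ
  have hlarge (t : ℝ) : ∀ᶠ n : ℕ in F, t ∈ Ioo (-(n + 1 : ℝ)) (n + 1) := by
    have : ∀ᶠ n : ℕ in atTop, |t| < n := tendsto_natCast_atTop_atTop.eventually_gt_atTop |t|
    filter_upwards [Nat.hyperfilter_le_atTop this] with n hn
    have hn' : |t| < n + 1 := lt_add_of_lt_of_pos hn one_pos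
    exact abs_lt.1 hn'
  have h0 (n : ℕ) : (0 : ℝ) ∈ Ioo (-(n + 1 : ℝ)) (n + 1) := ⟨neg_lt_zero.2 (hpos n), hpos n⟩
  have hvlim (t : ℝ) : ∃ l, Tendsto (fun n => v n t) F (𝓝 l) := by
    refine F.exists_tendsto_of_abs_le (C := |θ₁| + K * |t|) ?_
    filter_upwards [hlarge t] with n hn
    have h1 := hlip n hn (h0 n)
    rw [hv0, sub_zero] at h1
    linarith [abs_sub_abs_le_abs_sub (v n t) θ₁]
  have hxlim (t : ℝ) : ∃ l, Tendsto (fun n => x n t) F (𝓝 l) := by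
    refine F.exists_tendsto_of_abs_le (C := |θ₀ + t * θ₁| + K * t ^ 2) ?_
    filter_upwards [hlarge t] with n hn
    have h1 := hquad n hn (h0 n)
    rw [hv0, hx0, sub_zero, sub_sub] at h1
    linarith [abs_sub_abs_le_abs_sub (x n t) (θ₀ + t * θ₁)]
  choose θd hθd using hvlim
  choose θ hθ using hxlim
  have hlipθd : LipschitzWith K θd := LipschitzWith.of_dist_le_mul fun s t => by
    refine le_of_tendsto ((hθd s).sub (hθd t)).abs ?_
    filter_upwards [hlarge s, hlarge t] with n hs ht using hlip n hs ht
  have hquadθ (t s : ℝ) : |θ s - θ t - (s - t) * θd t| ≤ K * (s - t) ^ 2 := by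
    refine le_of_tendsto (((hθ s).sub (hθ t)).sub ((hθd t).const_mul (s - t))).abs ?_
    filter_upwards [hlarge s, hlarge t] with n hs ht using hquad n hs ht
  refine ⟨θ, θd, ⟨fun t => hasDerivAt_of_abs_sub_le_sq (hquadθ t), ⟨K, hlipθd⟩, ?_⟩,
    tendsto_nhds_unique (hθ 0) (by simp [hx0]), tendsto_nhds_unique (hθd 0) (by simp [hv0])⟩
  filter_upwards [hlipθd.ae_differentiableAt_real] with t hdiff
  refine ⟨deriv θd t, hdiff.hasDerivAt, ?_⟩
  rw [uIcc, mem_Icc]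
  set m := dm (θ t) ⊓ dp (θ t)
  set M := dm (θ t) ⊔ dp (θ t)
  suffices hε : ∀ ε > 0, -deriv θd t ∈ Icc (m - ε) (M + ε) from
    ⟨le_of_forall_pos_le_add fun ε hε' => by linarith [(hε ε hε').1],
      le_of_forall_pos_le_add fun ε hε' => (hε ε hε').2⟩
  intro ε hε
  obtain ⟨δ, hδ, hδ'⟩ := husc (θ t) ε hε
  have hdpmem (y : ℝ) (hy : |y - θ t| < δ) : dp y ∈ Icc (m - ε) (M + ε) := by
    obtain ⟨y₀, hy₀, h⟩ := hδ' y hy (dp y) right_mem_uIcc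
    rw [abs_lt] at h
    exact ⟨by linarith [hy₀.1, h.1], by linarith [hy₀.2, h.2]⟩
  set B : ℝ := |θd t| + 1 + K
  have hB : 0 < B := by positivity
  set ρ : ℝ := min 1 (δ / 3 / B)
  have hρ : 0 < ρ := by positivity
  have hρB : B * ρ ≤ δ / 3 := by
    rw [mul_comm]; exact (le_div_iff₀ hB).1 (min_le_right _ _)
  have hincr : ∀ h ∈ Ioo 0 ρ, -(M + ε) * h ≤ θd (t + h) - θd t ∧
      θd (t + h) - θd t ≤ -(m - ε) * h := by
    rintro h ⟨hh0, hhρ⟩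
    have hh1 : h < 1 := hhρ.trans_le (min_le_left _ _)
    have hinv : ∀ᶠ n : ℕ in F, ((n : ℝ) + 1)⁻¹ < δ / 3 := by
      have h := (tendsto_one_div_add_atTop_nhds_zero_nat (𝕜 := ℝ)).eventually_lt_const
        (show (0 : ℝ) < δ / 3 by positivity)
      filter_upwards [Nat.hyperfilter_le_atTop h] with n hn
      rwa [one_div] at hn
    have hevent : ∀ᶠ n in F, -(M + ε) * h ≤ v n (t + h) - v n t ∧
        v n (t + h) - v n t ≤ -(m - ε) * h := by
      filter_upwards [hinv, hlarge t, hlarge (t + h),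
        (Metric.tendsto_nhds.1 (hθ t)) (δ / 3) (by positivity),
        (Metric.tendsto_nhds.1 (hθd t)) 1 one_pos] with n hn ht hth hxn hvn
      rw [Real.dist_eq] at hxn hvn
      have hsub : Icc t (t + h) ⊆ Ioo (-(n + 1 : ℝ)) (n + 1) := ordConnected_Ioo.out ht hth
      have hvt : |v n t| ≤ |θd t| + 1 := by
        linarith [abs_sub_abs_le_abs_sub (v n t) (θd t)]
      have key := mul_sub_le_sub_le_of_right_deriv_mem (f := v n) (m := -(M + ε))
        (M := -(m - ε)) (a := t) (b := t + h) (by linarith)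
        (fun s hs => (hxv n s (hsub hs)).2.1.continuousAt.continuousWithinAt)
        (fun s hs => (hxv n s (hsub (Ico_subset_Icc_self hs))).2.1.hasDerivWithinAt) ?_
      · rwa [add_sub_cancel_left] at key
      intro s hs
      have hs' : |x n s - x n t| ≤ δ / 3 := by
        have h1 := hquad n (hsub (Ico_subset_Icc_self hs)) ht
        have h2 : 0 ≤ s - t := by linarith [hs.1]
        have h3 : s - t ≤ ρ := by linarith [hs.2]
        have h4 : s - t ≤ 1 := by linarith [hs.2]
        have h5 := abs_sub_abs_le_abs_sub (x n s - x n t) ((s - t) * v n t)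
        rw [abs_mul, abs_of_nonneg h2] at h5
        have h6 : (s - t) * |v n t| ≤ (s - t) * (|θd t| + 1) := by gcongr
        have h7 : (K : ℝ) * (s - t) ^ 2 ≤ K * (s - t) := by
          gcongr; nlinarith
        have h8 : B * (s - t) ≤ B * ρ := by gcongr
        simp only [B] at h8 hρB
        linarith
      have hslope := hU.slope_mem_Icc_of_right_deriv_mem hdp (x := x n s)
        (inv_pos.2 (hpos n)) (m := m - ε) (M := M + ε) fun y hy => hdpmem y (by
          rw [abs_le] at hs'
          rw [abs_lt] at hxn ⊢
          constructor <;> linarith [hy.1, hy.2])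
      exact ⟨neg_le_neg hslope.2, neg_le_neg hslope.1⟩
    have hlim := (hθd (t + h)).sub (hθd t)
    exact ⟨ge_of_tendsto hlim (hevent.mono fun n hn => hn.1),
      le_of_tendsto hlim (hevent.mono fun n hn => hn.2)⟩
  have hslope := hdiff.hasDerivAt.tendsto_slope_zero_right
  have hev : ∀ᶠ h in 𝓝[>] (0 : ℝ), h⁻¹ • (θd (t + h) - θd t) ∈ Icc (-(M + ε)) (-(m - ε)) := by
    filter_upwards [Ioo_mem_nhdsGT hρ] with h hh
    rw [smul_eq_mul, inv_mul_eq_div]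
    exact ⟨(le_div_iff₀ hh.1).2 (hincr h hh).1, (div_le_iff₀ hh.1).2 (hincr h hh).2⟩
  have hmem := isClosed_Icc.mem_of_tendsto hslope hev
  exact ⟨by linarith [hmem.2], by linarith [hmem.1]⟩

/-- A function whose derivative has no zero on a convex set is injective there. -/
theorem injOn_of_hasDerivAt_ne_zero {f f' : ℝ → ℝ} {s : Set ℝ} (hs : s.OrdConnected)
    (hf : ∀ x ∈ s, HasDerivAt f (f' x) x) (hf' : ∀ x ∈ s, f' x ≠ 0) : InjOn f s := by
  have key : ∀ x ∈ s, ∀ y ∈ s, x < y → f x ≠ f y := fun x hx y hy hxy h => by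
    have hsub := hs.out hx hy
    obtain ⟨c, hc, hc0⟩ := exists_hasDerivAt_eq_zero hxy
      (fun z hz => (hf z (hsub hz)).continuousAt.continuousWithinAt) h
      (fun z hz => hf z (hsub (Ioo_subset_Icc_self hz)))
    exact hf' c (hsub (Ioo_subset_Icc_self hc)) hc0
  intro x hx y hy h
  by_contra hne
  rcases lt_or_gt_of_ne hne with hlt | hlt
  · exact key x hx y hy hlt h
  · exact key y hy x hx hlt h.symm

/-- Conservation of energy as long as the velocity does not vanish. -/
theorem SolInclusion.energy_eq {U dm dp θ θd : ℝ → ℝ} {K : ℝ≥0} (h : SolInclusion dm dp θ θd)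
    (hU : LipschitzWith K U) (hdm : ∀ x, HasDerivWithinAt U (dm x) (Iic x) x)
    (hdp : ∀ x, HasDerivWithinAt U (dp x) (Ici x) x) (hcnt : {x | dm x ≠ dp x}.Countable) {t : ℝ}
    (hne : ∀ s ∈ uIcc 0 t, θd s ≠ 0) :
    1 / 2 * θd t ^ 2 + U (θ t) = 1 / 2 * θd 0 ^ 2 + U (θ 0) := by
  obtain ⟨hθ, ⟨L, hL⟩, hae⟩ := h
  have hderiv : deriv θ = θd := funext fun s => (hθ s).deriv
  have hC1 : ContDiff ℝ 1 θ :=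
    contDiff_one_iff_deriv.2 ⟨fun s => (hθ s).differentiableAt, hderiv ▸ hL.continuous⟩
  obtain ⟨L', hL'⟩ := (hC1.contDiffOn (s := uIcc 0 t)).exists_lipschitzOnWith (by decide)
    (convex_Icc _ _) isCompact_Icc
  have hacθd : AbsolutelyContinuousOnInterval θd 0 t :=
    (hL.lipschitzOnWith).absolutelyContinuousOnInterval
  have hac : AbsolutelyContinuousOnInterval (fun s => 1 / 2 * (θd s * θd s) + U (θ s)) 0 t :=
    ((hacθd.mul hacθd).const_mul (1 / 2)).add
      (hU.comp_lipschitzOnWith hL').absolutelyContinuousOnInterval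
  have hinj : InjOn θ (uIcc 0 t) :=
    injOn_of_hasDerivAt_ne_zero ordConnected_uIcc (fun s _ => hθ s) hne
  have hcorner : {s ∈ uIcc 0 t | dm (θ s) ≠ dp (θ s)}.Countable :=
    MapsTo.countable_of_injOn (fun s hs => hs.2) (hinj.mono fun s hs => hs.1) hcnt
  have hint := hac.integral_deriv_eq_sub
  rw [intervalIntegral.integral_zero_ae] at hint
  · simp only [← sq] at hint
    linarith
  filter_upwards [hae, hcorner.ae_notMem volume] with s ⟨d, hd, hmem⟩ hs hst
  have heq : dm (θ s) = dp (θ s) := by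
    by_contra hne'
    exact hs ⟨uIoc_subset_uIcc hst, hne'⟩
  have hUs : HasDerivAt U (dp (θ s)) (θ s) := by
    have := (heq ▸ hdm (θ s)).union (hdp (θ s))
    rwa [Iic_union_Ici, hasDerivWithinAt_univ] at this
  rw [heq, uIcc_self, mem_singleton_iff] at hmem
  have := ((hd.mul hd).const_mul (1 / 2)).add (hUs.comp s (hθ s))
  refine (this.congr_deriv ?_).deriv
  rw [← hmem]
  ring

theorem exists_ball_energy_pos {U : ℝ → ℝ} (hU : Continuous U) {x₀ v₀ E : ℝ} (hv₀ : v₀ ≠ 0)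
    (hE : E = 1 / 2 * v₀ ^ 2 + U x₀) : ∃ ρ > 0, ∀ x ∈ Metric.ball x₀ ρ, 0 < E - U x := by
  have hpos : 0 < E - U x₀ := by rw [hE]; ring_nf; positivity
  exact Metric.eventually_nhds_iff_ball.1
    ((continuous_const.sub hU).continuousAt.eventually_const_lt hpos)

theorem hasDerivAt_quadrature {U : ℝ → ℝ} (hU : Continuous U) {x₀ E ρ : ℝ}
    (hpos : ∀ x ∈ Metric.ball x₀ ρ, 0 < E - U x) {x : ℝ} (hx : x ∈ Metric.ball x₀ ρ) :
    HasDerivAt (fun u => ∫ ψ in x₀..u, (√(E - U ψ))⁻¹) (√(E - U x))⁻¹ x := by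
  have hcont : Continuous fun ψ => √(E - U ψ) := (continuous_const.sub hU).sqrt
  have hat : ∀ y ∈ Metric.ball x₀ ρ, ContinuousAt (fun ψ => (√(E - U ψ))⁻¹) y := fun y hy =>
    hcont.continuousAt.inv₀ (Real.sqrt_pos.2 (hpos y hy)).ne'
  have hsub : uIcc x₀ x ⊆ Metric.ball x₀ ρ :=
    (convex_ball x₀ ρ).ordConnected.uIcc_subset
      (Metric.mem_ball_self (dist_nonneg.trans_lt hx)) hx
  exact intervalIntegral.integral_hasDerivAt_right
    (ContinuousOn.intervalIntegrable fun y hy => (hat y (hsub hy)).continuousWithinAt)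
    hcont.measurable.inv.stronglyMeasurable.stronglyMeasurableAtFilter (hat x hx)

theorem injOn_quadrature {U : ℝ → ℝ} (hU : Continuous U) {x₀ E ρ : ℝ}
    (hpos : ∀ x ∈ Metric.ball x₀ ρ, 0 < E - U x) :
    InjOn (fun u => ∫ ψ in x₀..u, (√(E - U ψ))⁻¹) (Metric.ball x₀ ρ) :=
  injOn_of_hasDerivAt_ne_zero (convex_ball x₀ ρ).ordConnected
    (fun _ hx => hasDerivAt_quadrature hU hpos hx)
    fun x hx => ne_of_gt (inv_pos.2 (Real.sqrt_pos.2 (hpos x hx)))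

/-- A solution with nonzero initial velocity is given near `0` by inverting the energy integral. -/
theorem SolInclusion.exists_quadrature {U dm dp θ θd : ℝ → ℝ} {K : ℝ≥0}
    (h : SolInclusion dm dp θ θd) (hU : LipschitzWith K U)
    (hdm : ∀ x, HasDerivWithinAt U (dm x) (Iic x) x)
    (hdp : ∀ x, HasDerivWithinAt U (dp x) (Ici x) x) (hcnt : {x | dm x ≠ dp x}.Countable)
    {θ₀ θ₁ E ρ : ℝ} (hθ₁ : θ₁ ≠ 0) (hE : E = 1 / 2 * θ₁ ^ 2 + U θ₀) (h0 : θ 0 = θ₀)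
    (hd0 : θd 0 = θ₁) (hρ : 0 < ρ) (hpos : ∀ x ∈ Metric.ball θ₀ ρ, 0 < E - U x) :
    ∃ ε > 0, ∀ t, |t| < ε → θ t ∈ Metric.ball θ₀ ρ ∧
      √2 * t = Real.sign θ₁ * ∫ ψ in θ₀..(θ t), (√(E - U ψ))⁻¹ := by
  have hcont : Continuous θd := h.2.1.choose_spec.continuous
  have hmem : ∀ᶠ t in 𝓝 0, θ t ∈ Metric.ball θ₀ ρ :=
    (h.1 0).continuousAt.eventually_mem (by rw [h0]; exact Metric.ball_mem_nhds _ hρ)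
  have hsgn : ∀ᶠ t in 𝓝 0, 0 < Real.sign θ₁ * θd t := by
    refine (continuous_const.mul hcont).continuousAt.eventually_const_lt ?_
    rw [Pi.mul_apply, hd0]
    exact Real.sign_mul_pos_of_ne_zero θ₁ hθ₁
  obtain ⟨ε, hε, hball⟩ := Metric.eventually_nhds_iff_ball.1 (hmem.and hsgn)
  have hord : (Metric.ball (0 : ℝ) ε).OrdConnected := (convex_ball 0 ε).ordConnected
  have h0mem : (0 : ℝ) ∈ Metric.ball 0 ε := Metric.mem_ball_self hε
  have hss : Real.sign θ₁ * Real.sign θ₁ = 1 := by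
    rcases hθ₁.lt_or_gt with hlt | hlt
    · simp [Real.sign_of_neg hlt]
    · simp [Real.sign_of_pos hlt]
  have hsqrt : ∀ t ∈ Metric.ball 0 ε, Real.sign θ₁ * θd t = √2 * √(E - U (θ t)) := by
    intro t ht
    have hen := h.energy_eq hU hdm hdp hcnt (t := t) fun s hs hs0 => by
      simpa [hs0] using (hball s (hord.uIcc_subset h0mem ht hs)).2
    rw [h0, hd0, ← hE] at hen
    rw [← Real.sqrt_mul zero_le_two, eq_comm,
      Real.sqrt_eq_iff_mul_self_eq_of_pos (hball t ht).2]
    linear_combination θd t ^ 2 * hss + 2 * hen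
  have hderiv : ∀ t ∈ Metric.ball 0 ε, HasDerivAt
      (fun s => Real.sign θ₁ * (∫ ψ in θ₀..(θ s), (√(E - U ψ))⁻¹) - √2 * s) 0 t := by
    intro t ht
    have hF := (hasDerivAt_quadrature hU.continuous hpos (hball t ht).1).comp t (h.1 t)
    refine ((hF.const_mul (Real.sign θ₁)).sub
      ((hasDerivAt_id t).const_mul √2)).congr_deriv ?_
    have hne : √(E - U (θ t)) ≠ 0 := (Real.sqrt_pos.2 (hpos _ (hball t ht).1)).ne'
    rw [mul_left_comm, hsqrt t ht]
    field_simp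
    ring
  refine ⟨ε, hε, fun t ht => ?_⟩
  have htmem : t ∈ Metric.ball 0 ε := by simpa using ht
  refine ⟨(hball t htmem).1, ?_⟩
  have := Metric.isOpen_ball.is_const_of_deriv_eq_zero (convex_ball (0 : ℝ) ε).isPreconnected
    (fun s hs => (hderiv s hs).differentiableAt.differentiableWithinAt)
    (fun s hs => (hderiv s hs).deriv) htmem h0mem
  simp only [h0, intervalIntegral.integral_same, mul_zero, sub_zero] at this
  linarith

end

/-- With nonzero initial velocity `θ₁ ≠ 0` and `E = ½θ₁² + U(θ₀)`:
a solution of `θ'' ∈ -∂U(θ)` with `θ(0) = θ₀`, `θ'(0) = θ₁` exists, any two such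
solutions coincide near `0`, and every such solution satisfies
`√2 t = sgn(θ₁) ∫_{θ₀}^{θ(t)} (E - U(ψ))^{-1/2} dψ` near `0`. -/
theorem stmt_6 (U dm dp : ℝ → ℝ) (K : NNReal) (hU : LipschitzWith K U)
    (hdm : ∀ x : ℝ, HasDerivWithinAt U (dm x) (Set.Iic x) x)
    (hdp : ∀ x : ℝ, HasDerivWithinAt U (dp x) (Set.Ici x) x)
    (hcnt : {x : ℝ | dm x ≠ dp x}.Countable)
    (husc : ∀ x : ℝ, ∀ ε > (0 : ℝ), ∃ δ > (0 : ℝ), ∀ x' : ℝ, |x' - x| < δ →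
      ∀ y ∈ Set.uIcc (dm x') (dp x'), ∃ y₀ ∈ Set.uIcc (dm x) (dp x), |y - y₀| < ε)
    (θ₀ θ₁ : ℝ) (hθ₁ : θ₁ ≠ 0) (E : ℝ) (hE : E = (1 / 2) * θ₁ ^ 2 + U θ₀) :
    (∃ θ θd : ℝ → ℝ, SolInclusion dm dp θ θd ∧ θ 0 = θ₀ ∧ θd 0 = θ₁) ∧
    (∀ θ θd η ηd : ℝ → ℝ, SolInclusion dm dp θ θd → θ 0 = θ₀ → θd 0 = θ₁ →
      SolInclusion dm dp η ηd → η 0 = θ₀ → ηd 0 = θ₁ →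
      ∃ ε > (0 : ℝ), ∀ t : ℝ, |t| < ε → θ t = η t) ∧
    (∀ θ θd : ℝ → ℝ, SolInclusion dm dp θ θd → θ 0 = θ₀ → θd 0 = θ₁ →
      ∃ ε > (0 : ℝ), ∀ t : ℝ, |t| < ε →
        Real.sqrt 2 * t =
          Real.sign θ₁ * ∫ ψ in θ₀..(θ t), (Real.sqrt (E - U ψ))⁻¹) := by
  refine ⟨exists_solInclusion hU hdp husc θ₀ θ₁, ?_, ?_⟩
  · intro θ θd η ηd hθ hθ0 hθd0 hη hη0 hηd0
    obtain ⟨ρ, hρ, hpos⟩ := exists_ball_energy_pos hU.continuous hθ₁ hE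
    obtain ⟨ε₁, hε₁, h₁⟩ := hθ.exists_quadrature hU hdm hdp hcnt hθ₁ hE hθ0 hθd0 hρ hpos
    obtain ⟨ε₂, hε₂, h₂⟩ := hη.exists_quadrature hU hdm hdp hcnt hθ₁ hE hη0 hηd0 hρ hpos
    refine ⟨min ε₁ ε₂, lt_min hε₁ hε₂, fun t ht => ?_⟩
    obtain ⟨hmem₁, hF₁⟩ := h₁ t (ht.trans_le (min_le_left _ _))
    obtain ⟨hmem₂, hF₂⟩ := h₂ t (ht.trans_le (min_le_right _ _))
    have hsign : Real.sign θ₁ ≠ 0 := fun h => hθ₁ (Real.sign_eq_zero_iff.1 h)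
    exact injOn_quadrature hU.continuous hpos hmem₁ hmem₂
      (mul_left_cancel₀ hsign (hF₁.symm.trans hF₂))
  · intro θ θd hθ hθ0 hθd0
    obtain ⟨ρ, hρ, hpos⟩ := exists_ball_energy_pos hU.continuous hθ₁ hE
    obtain ⟨ε, hε, h⟩ := hθ.exists_quadrature hU hdm hdp hcnt hθ₁ hE hθ0 hθd0 hρ hpos
    exact ⟨ε, hε, fun t ht => (h t ht).2⟩
end

section
/- Let U : ℝ → ℝ be continuous on a right neighbourhood of θ₀ and suppose the right derivative U'₊(θ₀) = lim_{h→0⁺}(U(θ₀+h) − U(θ₀))/h exists and is negative. Then there exists ε > 0 such that U(θ) < U(θ₀) for all θ ∈ (θ₀, θ₀ + ε] and ∫_{θ₀}^{θ₀+ε} (U(θ₀) − U(θ))^{−1/2} dθ < ∞. -/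
open MeasureTheory

/-- If `U` is continuous on a right neighbourhood of `θ₀` with a negative
right derivative at `θ₀`, then `U < U(θ₀)` just to the right of `θ₀` and
`(U(θ₀) - U)^{-1/2}` is integrable on `[θ₀, θ₀ + ε]` for some `ε > 0`. -/
theorem stmt_10 (U : ℝ → ℝ) (θ₀ : ℝ)
    (hcont : ∃ δ > (0 : ℝ), ContinuousOn U (Set.Icc θ₀ (θ₀ + δ)))
    (d : ℝ) (hd : d < 0) (hderiv : HasDerivWithinAt U d (Set.Ici θ₀) θ₀) :
    ∃ ε > (0 : ℝ), (∀ θ ∈ Set.Ioc θ₀ (θ₀ + ε), U θ < U θ₀) ∧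
      IntervalIntegrable (fun ψ => (Real.sqrt (U θ₀ - U ψ))⁻¹) volume θ₀ (θ₀ + ε) := by
  obtain ⟨δ, hδ, hU⟩ := hcont
  have hslope : Filter.Tendsto (slope U θ₀) (nhdsWithin θ₀ (Set.Ioi θ₀)) (nhds d) :=
    (hasDerivWithinAt_iff_tendsto_slope' (by simp)).1 hderiv.Ioi_of_Ici
  have hev : ∀ᶠ θ in nhdsWithin θ₀ (Set.Ioi θ₀), slope U θ₀ θ < d / 2 :=
    hslope.eventually_lt_const (by linarith)
  obtain ⟨u, hu, hsub⟩ := mem_nhdsGT_iff_exists_Ioc_subset.1 hev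
  rw [Set.mem_Ioi] at hu
  have hε : 0 < min δ (u - θ₀) := lt_min hδ (by linarith)
  have hεδ := min_le_left δ (u - θ₀)
  have hεu := min_le_right δ (u - θ₀)
  set ε := min δ (u - θ₀)
  have hdrop : ∀ θ ∈ Set.Ioc θ₀ (θ₀ + ε), -d / 2 * (θ - θ₀) < U θ₀ - U θ := by
    intro θ hθ
    have hs : slope U θ₀ θ < d / 2 := hsub ⟨hθ.1, by linarith [hθ.2]⟩
    rw [slope_def_field, div_lt_iff₀ (sub_pos.2 hθ.1)] at hs
    linarith
  have hpos : ∀ θ ∈ Set.Ioc θ₀ (θ₀ + ε), 0 < -d / 2 * (θ - θ₀) := fun θ hθ =>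
    mul_pos (by linarith) (sub_pos.2 hθ.1)
  refine ⟨ε, hε, fun θ hθ => by linarith [hdrop θ hθ, hpos θ hθ], ?_⟩
  have hint : IntervalIntegrable (fun ψ => (Real.sqrt (-d / 2))⁻¹ * (ψ - θ₀) ^ (-(1 / 2) : ℝ))
      volume θ₀ (θ₀ + ε) := by
    have h := (intervalIntegral.intervalIntegrable_rpow' (a := 0) (b := ε)
      (r := -(1 / 2)) (by norm_num)).comp_sub_right θ₀
    rw [zero_add, add_comm ε] at h
    exact h.const_mul _
  have hι : Set.uIoc θ₀ (θ₀ + ε) = Set.Ioc θ₀ (θ₀ + ε) := Set.uIoc_of_le (by linarith)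
  refine hint.mono_fun' ?_ ?_
  · rw [hι]
    refine ContinuousOn.aestronglyMeasurable ?_ measurableSet_Ioc
    refine ContinuousOn.inv₀ (Real.continuous_sqrt.comp_continuousOn
      (continuousOn_const.sub (hU.mono fun θ hθ => ⟨hθ.1.le, by linarith [hθ.2]⟩))) ?_
    exact fun θ hθ => (Real.sqrt_pos.2 ((hpos θ hθ).trans (hdrop θ hθ))).ne'
  · rw [hι]
    filter_upwards [ae_restrict_mem measurableSet_Ioc] with θ hθ
    rw [Real.norm_of_nonneg (by positivity), Real.rpow_neg (sub_pos.2 hθ.1).le,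
      ← Real.sqrt_eq_rpow, ← mul_inv, ← Real.sqrt_mul (by linarith)]
    exact inv_anti₀ (Real.sqrt_pos.2 (hpos θ hθ)) (Real.sqrt_le_sqrt (hdrop θ hθ).le)
end

section
/- Let Ω ⊂ ℝ² be a nonempty compact convex set and s_Ω(x) = sup_{v ∈ Ω} ⟨x, v⟩ its support function. Let h : [0, T] → ℝ² be Lipschitz and u : [0, T] → ℝ² measurable such that for a.e. t: u(t) ∈ Ω, ⟨u(t), h(t)⟩ = s_Ω(h(t)), and ⟨u(t), h'(t)⟩ = 0. Then the function t ↦ s_Ω(h(t)) is constant on [0, T]. -/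
open MeasureTheory

/-- The support function of a set `Ω ⊆ ℝ²`: `s_Ω(x) = sup_{v ∈ Ω} ⟨x, v⟩`. -/
noncomputable def suppFn (Ω : Set (ℝ × ℝ)) (x : ℝ × ℝ) : ℝ :=
  sSup ((fun v : ℝ × ℝ => x.1 * v.1 + x.2 * v.2) '' Ω)

/-- The functional `v ↦ ⟨x, v⟩` is bounded above on a compact set. -/
theorem bddAbove_suppFn_image {Ω : Set (ℝ × ℝ)} (hcomp : IsCompact Ω) (x : ℝ × ℝ) :
    BddAbove ((fun v : ℝ × ℝ => x.1 * v.1 + x.2 * v.2) '' Ω) :=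
  (hcomp.image (by fun_prop)).bddAbove

theorem le_suppFn {Ω : Set (ℝ × ℝ)} (hcomp : IsCompact Ω) (x : ℝ × ℝ) {v : ℝ × ℝ} (hv : v ∈ Ω) :
    v.1 * x.1 + v.2 * x.2 ≤ suppFn Ω x := by
  have := le_csSup (bddAbove_suppFn_image hcomp x) ⟨v, hv, rfl⟩
  simpa only [suppFn, mul_comm] using this

/-- The support function of a nonempty compact set is Lipschitz. -/
theorem exists_lipschitzWith_suppFn {Ω : Set (ℝ × ℝ)} (hne : Ω.Nonempty) (hcomp : IsCompact Ω) :
    ∃ C : NNReal, LipschitzWith C (suppFn Ω) := by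
  obtain ⟨M, hM⟩ := hcomp.isBounded.exists_norm_le
  refine ⟨_, LipschitzWith.of_le_add_mul' (M + M) fun x y => ?_⟩
  refine csSup_le (hne.image _) ?_
  rintro _ ⟨v, hv, rfl⟩
  have hy := le_suppFn hcomp y hv
  have bound {a b : ℝ} (ha : |a| ≤ dist x y) (hb : |b| ≤ ‖v‖) : a * b ≤ dist x y * M :=
    calc a * b ≤ |a| * |b| := by rw [← abs_mul]; exact le_abs_self _
      _ ≤ dist x y * M := by gcongr; exact hb.trans (hM v hv)
  have h₁ := bound (a := x.1 - y.1) (by rw [dist_eq_norm]; exact norm_fst_le (x - y))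
    (norm_fst_le v)
  have h₂ := bound (a := x.2 - y.2) (by rw [dist_eq_norm]; exact norm_snd_le (x - y))
    (norm_snd_le v)
  simp only
  linarith

/-- If `v ∈ Ω` attains the support function at `h t`, then `v` is a subgradient there, so a
derivative of `suppFn Ω ∘ h` at `t` equals `⟨v, h' t⟩`. -/
theorem deriv_suppFn_comp_eq {Ω : Set (ℝ × ℝ)} (hcomp : IsCompact Ω) {h : ℝ → ℝ × ℝ}
    {t : ℝ} {v d : ℝ × ℝ} {F' : ℝ} (hv : v ∈ Ω)
    (hmax : v.1 * (h t).1 + v.2 * (h t).2 = suppFn Ω (h t))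
    (hh : HasDerivAt h d t) (hF : HasDerivAt (fun τ => suppFn Ω (h τ)) F' t) :
    F' = v.1 * d.1 + v.2 * d.2 := by
  have hlin : HasDerivAt (fun τ => v.1 * (h τ).1 + v.2 * (h τ).2) (v.1 * d.1 + v.2 * d.2) t := by
    have h₁ : HasDerivAt (fun τ => (h τ).1) d.1 t :=
      (ContinuousLinearMap.fst ℝ ℝ ℝ).hasFDerivAt.comp_hasDerivAt t hh
    have h₂ : HasDerivAt (fun τ => (h τ).2) d.2 t :=
      (ContinuousLinearMap.snd ℝ ℝ ℝ).hasFDerivAt.comp_hasDerivAt t hh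
    exact (h₁.const_mul v.1).add (h₂.const_mul v.2)
  have hmin : IsLocalMin
      (fun τ => suppFn Ω (h τ) - (v.1 * (h τ).1 + v.2 * (h τ).2)) t := by
    refine Filter.Eventually.of_forall fun τ => ?_
    simp only [hmax, sub_self, sub_nonneg]
    exact le_suppFn hcomp (h τ) hv
  exact sub_eq_zero.mp (hmin.hasDerivAt_eq_zero (hF.sub hlin))

/-- If `h : [0, T] → ℝ²` is Lipschitz and the measurable control `u`
satisfies (a.e.) `u(t) ∈ Ω`, `⟨u(t), h(t)⟩ = s_Ω(h(t))` and `⟨u(t), h'(t)⟩ = 0`, then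
`t ↦ s_Ω(h(t))` is constant on `[0, T]`. -/
theorem stmt_11 (Ω : Set (ℝ × ℝ)) (hne : Ω.Nonempty) (hcomp : IsCompact Ω)
    (hconv : Convex ℝ Ω) (T : ℝ) (hT : 0 ≤ T)
    (h : ℝ → ℝ × ℝ) (K : NNReal) (hLip : LipschitzOnWith K h (Set.Icc 0 T))
    (u : ℝ → ℝ × ℝ) (humeas : Measurable u)
    (hae : ∀ᵐ t ∂volume, t ∈ Set.Icc 0 T →
      u t ∈ Ω ∧
      (u t).1 * (h t).1 + (u t).2 * (h t).2 = suppFn Ω (h t) ∧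
      ∃ hd : ℝ × ℝ, HasDerivWithinAt h hd (Set.Icc 0 T) t ∧
        (u t).1 * hd.1 + (u t).2 * hd.2 = 0) :
    ∀ s ∈ Set.Icc (0 : ℝ) T, ∀ t ∈ Set.Icc (0 : ℝ) T, suppFn Ω (h s) = suppFn Ω (h t) := by
  obtain ⟨C, hC⟩ := exists_lipschitzWith_suppFn hne hcomp
  have hAC : AbsolutelyContinuousOnInterval (fun τ => suppFn Ω (h τ)) 0 T := by
    refine LipschitzOnWith.absolutelyContinuousOnInterval (K := C * K) ?_
    rw [Set.uIcc_of_le hT]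
    exact hC.comp_lipschitzOnWith hLip
  have hzero : ∀ᵐ t ∂volume, t ∈ Set.uIcc 0 T → HasDerivAt (fun τ => suppFn Ω (h τ)) 0 t := by
    filter_upwards [hae, hAC.ae_differentiableAt, Measure.ae_ne volume 0, Measure.ae_ne volume T]
      with t ht hdiff h0 hT' htmem
    have htI := htmem
    rw [Set.uIcc_of_le hT] at htI
    obtain ⟨hu, hmax, d, hd, horth⟩ := ht htI
    have hh := hd.hasDerivAt (Icc_mem_nhds (htI.1.lt_of_ne' h0) (htI.2.lt_of_ne hT'))
    have hF := (hdiff htmem).hasDerivAt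
    rwa [deriv_suppFn_comp_eq hcomp hu hmax hh hF, horth] at hF
  obtain ⟨c, hc⟩ := hAC.const_of_ae_hasDerivAt_zero hzero
  rw [Set.uIcc_of_le hT] at hc
  intro s hs t ht
  exact (hc s hs).trans (hc t ht).symm
end

section
/- Fix p, q ∈ ℝ. Let u₁, u₂ : [0, T] → ℝ be integrable and let h = (h₁, h₂, h₃) : [0, T] → ℝ³ be absolutely continuous with h₁'(t) = −h₃(t)u₂(t), h₂'(t) = h₃(t)u₁(t), h₃'(t) = (q − h₂(t))u₁(t) + (h₁(t) − p)u₂(t) for a.e. t. Then the function E(t) = ½·h₃(t)² + ½·(h₁(t)² + h₂(t)²) − p·h₁(t) − q·h₂(t) is constant on [0, T]. -/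
open MeasureTheory intervalIntegral

/-- A constant plus the primitive of an interval integrable function is absolutely continuous. -/
theorem IntervalIntegrable.absolutelyContinuousOnInterval_const_add_integral {f : ℝ → ℝ} {a b : ℝ}
    (hf : IntervalIntegrable f volume a b) (c : ℝ) :
    AbsolutelyContinuousOnInterval (fun x => c + ∫ t in a..x, f t) a b :=
  ((LipschitzWith.const c).lipschitzOnWith.absolutelyContinuousOnInterval).fun_add
    (hf.absolutelyContinuousOnInterval_intervalIntegral Set.left_mem_uIcc)

/-- Along any absolutely continuous solution of the rolling-ball vertical
subsystem `h₁' = -h₃u₂`, `h₂' = h₃u₁`, `h₃' = (q - h₂)u₁ + (h₁ - p)u₂` (encoded via the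
integral equations) with integrable controls, the energy
`E = ½h₃² + ½(h₁² + h₂²) - p h₁ - q h₂` is constant. -/
theorem stmt_13 (p q T : ℝ) (hT : 0 ≤ T) (u1 u2 h1 h2 h3 : ℝ → ℝ)
    (hu1 : IntervalIntegrable u1 volume 0 T)
    (hu2 : IntervalIntegrable u2 volume 0 T)
    (hc1 : ContinuousOn h1 (Set.Icc 0 T))
    (hc2 : ContinuousOn h2 (Set.Icc 0 T))
    (hc3 : ContinuousOn h3 (Set.Icc 0 T))
    (hi1 : IntervalIntegrable (fun s => h3 s * u2 s) volume 0 T)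
    (hi2 : IntervalIntegrable (fun s => h3 s * u1 s) volume 0 T)
    (hi3 : IntervalIntegrable
      (fun s => (q - h2 s) * u1 s + (h1 s - p) * u2 s) volume 0 T)
    (he1 : ∀ t ∈ Set.Icc 0 T, h1 t = h1 0 + ∫ s in (0 : ℝ)..t, -(h3 s * u2 s))
    (he2 : ∀ t ∈ Set.Icc 0 T, h2 t = h2 0 + ∫ s in (0 : ℝ)..t, h3 s * u1 s)
    (he3 : ∀ t ∈ Set.Icc 0 T, h3 t = h3 0 +
      ∫ s in (0 : ℝ)..t, (q - h2 s) * u1 s + (h1 s - p) * u2 s) :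
    ∀ s ∈ Set.Icc (0 : ℝ) T, ∀ t ∈ Set.Icc (0 : ℝ) T,
      (1 / 2) * h3 s ^ 2 + (1 / 2) * (h1 s ^ 2 + h2 s ^ 2) - p * h1 s - q * h2 s =
        (1 / 2) * h3 t ^ 2 + (1 / 2) * (h1 t ^ 2 + h2 t ^ 2) - p * h1 t - q * h2 t := by
  have hi1' : IntervalIntegrable (fun s => -(h3 s * u2 s)) volume 0 T := hi1.neg
  let H1 : ℝ → ℝ := fun t => h1 0 + ∫ s in (0 : ℝ)..t, -(h3 s * u2 s)
  let H2 : ℝ → ℝ := fun t => h2 0 + ∫ s in (0 : ℝ)..t, h3 s * u1 s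
  let H3 : ℝ → ℝ := fun t => h3 0 + ∫ s in (0 : ℝ)..t, (q - h2 s) * u1 s + (h1 s - p) * u2 s
  have ac1 : AbsolutelyContinuousOnInterval H1 0 T :=
    hi1'.absolutelyContinuousOnInterval_const_add_integral (h1 0)
  have ac2 : AbsolutelyContinuousOnInterval H2 0 T :=
    hi2.absolutelyContinuousOnInterval_const_add_integral (h2 0)
  have ac3 : AbsolutelyContinuousOnInterval H3 0 T :=
    hi3.absolutelyContinuousOnInterval_const_add_integral (h3 0)
  let E : ℝ → ℝ := fun t =>
    (1 / 2) * (H3 t * H3 t + (H1 t * H1 t + H2 t * H2 t)) - (p * H1 t + q * H2 t)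
  have acE : AbsolutelyContinuousOnInterval E 0 T :=
    (((ac3.fun_mul ac3).fun_add ((ac1.fun_mul ac1).fun_add (ac2.fun_mul ac2))).const_mul
      (1 / 2)).fun_sub ((ac1.const_mul p).fun_add (ac2.const_mul q))
  have hE : ∀ᵐ x, x ∈ Set.uIcc 0 T → HasDerivAt E 0 x := by
    filter_upwards [hi1'.ae_hasDerivAt_integral, hi2.ae_hasDerivAt_integral,
      hi3.ae_hasDerivAt_integral] with x d1 d2 d3 hx
    have D1 : HasDerivAt H1 _ x := (d1 hx 0 Set.left_mem_uIcc).const_add (h1 0)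
    have D2 : HasDerivAt H2 _ x := (d2 hx 0 Set.left_mem_uIcc).const_add (h2 0)
    have D3 : HasDerivAt H3 _ x := (d3 hx 0 Set.left_mem_uIcc).const_add (h3 0)
    have hx' : x ∈ Set.Icc 0 T := Set.uIcc_of_le hT ▸ hx
    have e1 : H1 x = h1 x := (he1 x hx').symm
    have e2 : H2 x = h2 x := (he2 x hx').symm
    have e3 : H3 x = h3 x := (he3 x hx').symm
    refine ((((D3.fun_mul D3).fun_add ((D1.fun_mul D1).fun_add (D2.fun_mul D2))).const_mul
      (1 / 2)).fun_sub ((D1.const_mul p).fun_add (D2.const_mul q))).congr_deriv ?_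
    rw [e1, e2, e3]
    ring
  obtain ⟨C, hC⟩ := acE.const_of_ae_hasDerivAt_zero hE
  have key : ∀ t ∈ Set.Icc (0 : ℝ) T,
      (1 / 2) * h3 t ^ 2 + (1 / 2) * (h1 t ^ 2 + h2 t ^ 2) - p * h1 t - q * h2 t = C := by
    intro t ht
    have e1 : H1 t = h1 t := (he1 t ht).symm
    have e2 : H2 t = h2 t := (he2 t ht).symm
    have e3 : H3 t = h3 t := (he3 t ht).symm
    rw [← hC t (Set.uIcc_of_le hT ▸ ht)]
    simp only [E, e1, e2, e3]
    ring
  intro s hs t ht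
  rw [key s hs, key t ht]
end

section
/- Let Ω ⊂ ℝ² be a compact convex set with 0 in its interior and M = max{v₂ : v = (v₁, v₂) ∈ Ω} (so M > 0). Suppose (x̂, ŷ) : [0, T] → ℝ × (0, ∞) is an absolutely continuous trajectory of the system ẋ = y u₁, ẏ = y u₂ for some measurable control û : [0, T] → Ω with û₂(t) = M for a.e. t. Then for every T' ≥ 0 and every absolutely continuous trajectory (x, y) : [0, T'] → ℝ × (0, ∞) of the same system with some measurable control u : [0, T'] → Ω, if y(0) = ŷ(0) and y(T') = ŷ(T), then T' ≥ T. In other words, vertical trajectories are time-optimal. -/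
open MeasureTheory intervalIntegral

/-- `(x, y)` is an admissible trajectory on `[0, T]` of the system `x' = y u₁`, `y' = y u₂`
on the upper half-plane, with measurable control `u` taking values in `Ω`
(encoded via the integral equations, i.e. `(x, y)` absolutely continuous). -/
def LobTraj (Ω : Set (ℝ × ℝ)) (T : ℝ) (x y : ℝ → ℝ) (u : ℝ → ℝ × ℝ) : Prop :=
  (∀ t ∈ Set.Icc (0 : ℝ) T, 0 < y t) ∧
  Measurable u ∧ (∀ t ∈ Set.Icc (0 : ℝ) T, u t ∈ Ω) ∧
  ContinuousOn x (Set.Icc 0 T) ∧ ContinuousOn y (Set.Icc 0 T) ∧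
  IntervalIntegrable (fun s => y s * (u s).1) MeasureTheory.volume 0 T ∧
  IntervalIntegrable (fun s => y s * (u s).2) MeasureTheory.volume 0 T ∧
  (∀ t ∈ Set.Icc (0 : ℝ) T, x t = x 0 + ∫ s in (0 : ℝ)..t, y s * (u s).1) ∧
  (∀ t ∈ Set.Icc (0 : ℝ) T, y t = y 0 + ∫ s in (0 : ℝ)..t, y s * (u s).2)

/-- Integral form of Grönwall's inequality for a linear bound with constant coefficient. -/
theorem le_mul_exp_of_le_add_integral {M T : ℝ} {f : ℝ → ℝ} (hM : 0 ≤ M) (hT : 0 ≤ T)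
    (hf : ContinuousOn f (Set.Icc 0 T))
    (hle : ∀ t ∈ Set.Icc (0 : ℝ) T, f t ≤ f 0 + ∫ s in (0 : ℝ)..t, f s * M) :
    f T ≤ f 0 * Real.exp (M * T) := by
  have hfM : ContinuousOn (fun s => f s * M) (Set.Icc 0 T) := hf.mul continuousOn_const
  set G : ℝ → ℝ := fun t => f 0 + ∫ s in (0 : ℝ)..t, f s * M with hG
  have hGc : ContinuousOn G (Set.Icc 0 T) := by
    have := continuousOn_primitive_interval (μ := volume) (a := 0) (b := T)
      (f := fun s => f s * M) (by
        rw [Set.uIcc_of_le hT]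
        exact hfM.integrableOn_Icc)
    rw [Set.uIcc_of_le hT] at this
    exact continuousOn_const.add this
  have hGd : ∀ t ∈ Set.Ioo (0 : ℝ) T, HasDerivAt G (f t * M) t := by
    intro t ht
    have hnhds : Set.Icc (0 : ℝ) T ∈ nhds t := Icc_mem_nhds ht.1 ht.2
    refine (integral_hasDerivAt_right ?_ ?_ (hfM.continuousAt hnhds)).const_add (f 0)
    · exact (hfM.mono (Set.Icc_subset_Icc_right ht.2.le)).intervalIntegrable_of_Icc ht.1.le
    · exact ⟨Set.Icc 0 T, hnhds, hfM.aestronglyMeasurable measurableSet_Icc⟩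
  have hd : ∀ t ∈ Set.Ioo (0 : ℝ) T, HasDerivAt (fun t => G t * Real.exp (-(M * t)))
      (f t * M * Real.exp (-(M * t)) + G t * (Real.exp (-(M * t)) * -(M * 1))) t := fun t ht =>
    (hGd t ht).mul ((((hasDerivAt_id t).const_mul M).neg).exp)
  have hanti : AntitoneOn (fun t => G t * Real.exp (-(M * t))) (Set.Icc 0 T) := by
    refine antitoneOn_of_deriv_nonpos (convex_Icc 0 T)
      (hGc.mul (by fun_prop)) ?_ ?_
    · rw [interior_Icc]
      exact fun t ht => (hd t ht).differentiableAt.differentiableWithinAt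
    · rw [interior_Icc]
      intro t ht
      rw [(hd t ht).deriv]
      have h1 : 0 ≤ (G t - f t) * (M * Real.exp (-(M * t))) :=
        mul_nonneg (sub_nonneg.2 (hle t (Set.Ioo_subset_Icc_self ht))) (by positivity)
      linarith
  have h := hanti (Set.left_mem_Icc.2 hT) (Set.right_mem_Icc.2 hT) hT
  have hG0 : G 0 = f 0 := by simp [hG]
  simp only [hG0, mul_zero, neg_zero, Real.exp_zero, mul_one, Real.exp_neg,
    ← div_eq_mul_inv] at h
  exact (hle T (Set.right_mem_Icc.2 hT)).trans ((div_le_iff₀ (Real.exp_pos _)).1 h)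

/-- The greatest height attained in a planar set with `0` in its interior is positive. -/
theorem pos_of_isGreatest_snd_image {Ω : Set (ℝ × ℝ)} (h0 : (0 : ℝ × ℝ) ∈ interior Ω) {M : ℝ}
    (hM : IsGreatest (Prod.snd '' Ω) M) : 0 < M := by
  obtain ⟨ε, hε, hball⟩ := Metric.mem_nhds_iff.1 (mem_interior_iff_mem_nhds.1 h0)
  have hmem : ((0 : ℝ), ε / 2) ∈ Ω := hball (by simp [abs_of_pos hε, hε])
  have : ε / 2 ≤ M := hM.2 ⟨_, hmem, rfl⟩
  linarith

/-- The height of a trajectory grows at most exponentially, with rate the maximal vertical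
control. -/
theorem LobTraj.height_le {Ω : Set (ℝ × ℝ)} {M T : ℝ} {x y : ℝ → ℝ} {u : ℝ → ℝ × ℝ}
    (h : LobTraj Ω T x y u) (hM : 0 ≤ M) (hub : M ∈ upperBounds (Prod.snd '' Ω)) (hT : 0 ≤ T) :
    y T ≤ y 0 * Real.exp (M * T) := by
  obtain ⟨hpos, -, hu, -, hy, -, hint, -, heq⟩ := h
  refine le_mul_exp_of_le_add_integral hM hT hy fun t ht => ?_
  have hsub : Set.Icc 0 t ⊆ Set.Icc 0 T := Set.Icc_subset_Icc_right ht.2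
  rw [heq t ht]
  gcongr
  refine integral_mono_on ht.1 (hint.mono_set ?_) ?_ fun s hs => ?_
  · rwa [Set.uIcc_of_le ht.1, Set.uIcc_of_le hT]
  · exact ((hy.mono hsub).mul continuousOn_const).intervalIntegrable_of_Icc ht.1
  · exact mul_le_mul_of_nonneg_left (hub ⟨_, hu s (hsub hs), rfl⟩) (hpos s (hsub hs)).le

/-- The height of a vertical trajectory grows at least exponentially. -/
theorem LobTraj.le_height_of_vertical {Ω : Set (ℝ × ℝ)} {M T : ℝ} {x y : ℝ → ℝ}
    {u : ℝ → ℝ × ℝ} (h : LobTraj Ω T x y u) (hM : 0 ≤ M) (hT : 0 ≤ T)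
    (hvert : ∀ᵐ t ∂volume, t ∈ Set.Icc (0 : ℝ) T → (u t).2 = M) :
    y 0 * Real.exp (M * T) ≤ y T := by
  obtain ⟨-, -, -, -, hy, -, -, -, heq⟩ := h
  have key : -y T ≤ -y 0 * Real.exp (M * T) := by
    refine le_mul_exp_of_le_add_integral (f := fun t => -y t) hM hT hy.neg fun t ht => ?_
    have hcongr : ∫ s in (0 : ℝ)..t, y s * (u s).2 = ∫ s in (0 : ℝ)..t, y s * M := by
      refine integral_congr_ae ?_
      filter_upwards [hvert] with s hs hst
      rw [Set.uIoc_of_le ht.1] at hst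
      rw [hs ⟨hst.1.le, hst.2.trans ht.2⟩]
    simp only [neg_mul, intervalIntegral.integral_neg]
    rw [heq t ht, hcongr]
    linarith
  linarith

/-- Vertical trajectories, i.e. trajectories whose control has maximal
possible second coordinate `M` a.e., are time-optimal: any other admissible trajectory
joining the same initial and final heights takes at least as long. -/
theorem stmt_15 (Ω : Set (ℝ × ℝ)) (hcomp : IsCompact Ω) (hconv : Convex ℝ Ω)
    (h0 : (0 : ℝ × ℝ) ∈ interior Ω) (M : ℝ) (hM : IsGreatest (Prod.snd '' Ω) M)
    (T : ℝ) (hT : 0 ≤ T) (xh yh : ℝ → ℝ) (uh : ℝ → ℝ × ℝ)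
    (htraj : LobTraj Ω T xh yh uh)
    (hvert : ∀ᵐ t ∂volume, t ∈ Set.Icc (0 : ℝ) T → (uh t).2 = M)
    (T' : ℝ) (hT' : 0 ≤ T') (x y : ℝ → ℝ) (u : ℝ → ℝ × ℝ)
    (htraj' : LobTraj Ω T' x y u)
    (hinit : y 0 = yh 0) (hfin : y T' = yh T) :
    T ≤ T' := by
  have hMpos := pos_of_isGreatest_snd_image h0 hM
  have hlow := htraj.le_height_of_vertical hMpos.le hT hvert
  have hup := htraj'.height_le hMpos.le hM.2 hT'
  rw [hinit, hfin] at hup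
  have hy0 : 0 < yh 0 := htraj.1 0 (Set.left_mem_Icc.2 hT)
  exact le_of_mul_le_mul_left
    (Real.exp_le_exp.1 (le_of_mul_le_mul_left (hlow.trans hup) hy0)) hMpos
end
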